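/- Half-space Liouville with growth below s + ᾱ: let s ∈ (0,1) and let ᾱ > 0 be the boundary Harnack exponent of the class L_*(s). Suppose u ∈ C(ℝⁿ) is a viscosity solution of M⁺u ≥ 0 and M⁻u ≤ 0 in {x_n > 0}, u = 0 in {x_n < 0}, and satisfies ‖u‖_{L^∞(B_R)} ≤ C R^β for all R ≥ 1 for some β < s + ᾱ. Then u(x) = K ((x_n)_+)^s for some constant K. -/

import Mathlib

open MeasureTheory Metric Set
open scoped RealInnerProductSpace

/-- Spectral measures of the class `L_*`: measurable, even, `lam ≤ μ ≤ Lam` on the sphere. -/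
def SpecOK (n : ℕ) (lam Lam : ℝ) (μ : EuclideanSpace ℝ (Fin n) → ℝ) : Prop :=
  Measurable μ ∧ ∀ θ : EuclideanSpace ℝ (Fin n), ‖θ‖ = 1 →
    μ (-θ) = μ θ ∧ lam ≤ μ θ ∧ μ θ ≤ Lam

/-- The operator of the class `L_*(s)` with spectral measure `μ`. -/
noncomputable def kerOp (n : ℕ) (s : ℝ) (μ u : EuclideanSpace ℝ (Fin n) → ℝ)
    (x : EuclideanSpace ℝ (Fin n)) : ℝ :=
  (1 - s) * ∫ y : EuclideanSpace ℝ (Fin n),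
    ((u (x + y) + u (x - y)) / 2 - u x) * μ (‖y‖⁻¹ • y) / ‖y‖ ^ ((n : ℝ) + 2 * s)

/-- Extremal operator `M⁺` of the class `L_*(s)`. -/
noncomputable def Mplus (n : ℕ) (s lam Lam : ℝ) (u : EuclideanSpace ℝ (Fin n) → ℝ)
    (x : EuclideanSpace ℝ (Fin n)) : ℝ :=
  sSup {z : ℝ | ∃ μ, SpecOK n lam Lam μ ∧ z = kerOp n s μ u x}

/-- Extremal operator `M⁻` of the class `L_*(s)`. -/
noncomputable def Mminus (n : ℕ) (s lam Lam : ℝ) (u : EuclideanSpace ℝ (Fin n) → ℝ)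
    (x : EuclideanSpace ℝ (Fin n)) : ℝ :=
  sInf {z : ℝ | ∃ μ, SpecOK n lam Lam μ ∧ z = kerOp n s μ u x}

/-- `w` satisfies `M⁺ w ≥ 0` in `Ω` in the viscosity sense: whenever a `C²` function `φ`
touches `w` from above at `x` in a ball contained in `Ω`, the operator evaluated on
`φ` in the ball and `w` outside is nonnegative at `x`. -/
def ViscSub (n : ℕ) (s lam Lam : ℝ) (w : EuclideanSpace ℝ (Fin n) → ℝ)
    (Ω : Set (EuclideanSpace ℝ (Fin n))) : Prop :=
  ∀ x ∈ Ω, ∀ r : ℝ, 0 < r → ball x r ⊆ Ω →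
    ∀ φ : EuclideanSpace ℝ (Fin n) → ℝ, ContDiffOn ℝ 2 φ (ball x r) → φ x = w x →
      (∀ y ∈ ball x r, w y ≤ φ y) →
      0 ≤ Mplus n s lam Lam (fun y => if ‖y - x‖ < r then φ y else w y) x

/-- `w` satisfies `M⁻ w ≤ 0` in `Ω` in the viscosity sense: whenever a `C²` function `φ`
touches `w` from below at `x` in a ball contained in `Ω`, the operator evaluated on
`φ` in the ball and `w` outside is nonpositive at `x`. -/
def ViscSuper (n : ℕ) (s lam Lam : ℝ) (w : EuclideanSpace ℝ (Fin n) → ℝ)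
    (Ω : Set (EuclideanSpace ℝ (Fin n))) : Prop :=
  ∀ x ∈ Ω, ∀ r : ℝ, 0 < r → ball x r ⊆ Ω →
    ∀ φ : EuclideanSpace ℝ (Fin n) → ℝ, ContDiffOn ℝ 2 φ (ball x r) → φ x = w x →
      (∀ y ∈ ball x r, φ y ≤ w y) →
      Mminus n s lam Lam (fun y => if ‖y - x‖ < r then φ y else w y) x ≤ 0



lemma oneD_eps (s : ℝ) (hs0 : 0 < s) (hs1 : s < 1) (ε : ℝ) (he : 0 < ε) (he2 : ε ≤ 1/2) :
    |∫ t in Ioi ε, (((1+t)^s + (max (1-t) 0)^s - 2) * t^(-1-2*s))| ≤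
      (ε^2 * ε^(-2*s))/(2*s) + 2 * ε^3 * (ε/2)^(-1-2*s) := by
  set p : ℝ := -1-2*s with hp
  set δ : ℝ := ε/(1+ε) with hδ
  have hδ0 : 0 < δ := by positivity
  have hδε : δ ≤ ε := by
    rw [hδ, div_le_iff₀ (by linarith)]; nlinarith
  have hδε2 : ε/2 ≤ δ := by
    rw [hδ, le_div_iff₀ (by linarith)]; nlinarith
  have hεδ : ε - δ ≤ ε^2 := by
    have : δ * (1+ε) = ε := by rw [hδ]; field_simp
    nlinarith
  set J1 : ℝ → ℝ := fun τ => (1-(1-τ)^s)*(1-τ)^(s-1)*τ^p with hJ1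
  set J2 : ℝ → ℝ := fun τ => ((1-τ)^s - 1)*τ^p with hJ2
  set fA : ℝ → ℝ := fun t => ((1+t)^s-1)*t^p with hfA
  set fB : ℝ → ℝ := fun t => ((max (1-t) 0)^s-1)*t^p with hfB
  -- integrability of fA
  have hAint : IntegrableOn fA (Ioi ε) := by
    have h1 : IntegrableOn (fun t : ℝ => t^(-1-s)) (Ioi ε) :=
      integrableOn_Ioi_rpow_of_lt (by linarith) he
    refine Integrable.mono' h1 ?_ ?_
    · apply Measurable.aestronglyMeasurable
      fun_prop
    · refine (ae_restrict_iff' measurableSet_Ioi).2 (Filter.Eventually.of_forall ?_)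
      intro t ht
      have ht0 : 0 < t := he.trans ht
      have h2 : (1+t)^s ≤ 1 + t^s := by
        have := Real.rpow_add_le_add_rpow (p := s) zero_le_one ht0.le hs0.le hs1.le
        simpa using this
      have h3 : 1 ≤ (1+t)^s := Real.one_le_rpow (by linarith) hs0.le
      have h4 : 0 < t^p := Real.rpow_pos_of_pos ht0 _
      rw [Real.norm_eq_abs, abs_of_nonneg (mul_nonneg (by linarith) h4.le)]
      calc ((1+t)^s-1)*t^p ≤ t^s * t^p := by gcongr; linarith
        _ = t^(-1-s) := by rw [← Real.rpow_add ht0]; congr 1; rw [hp]; ring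
  have hBint : IntegrableOn fB (Ioi ε) := by
    have h1 : IntegrableOn (fun t : ℝ => t^p) (Ioi ε) :=
      integrableOn_Ioi_rpow_of_lt (by linarith) he
    refine Integrable.mono' h1 ?_ ?_
    · apply Measurable.aestronglyMeasurable
      fun_prop
    · refine (ae_restrict_iff' measurableSet_Ioi).2 (Filter.Eventually.of_forall ?_)
      intro t ht
      have ht0 : 0 < t := he.trans ht
      have h2 : (max (1-t) 0)^s ≤ 1 :=
        Real.rpow_le_one (le_max_right _ _) (max_le (by linarith) zero_le_one) hs0.le
      have h3 : 0 ≤ (max (1-t) 0)^s := Real.rpow_nonneg (le_max_right _ _) _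
      have h4 : 0 < t^p := Real.rpow_pos_of_pos ht0 _
      rw [Real.norm_eq_abs, abs_mul, abs_of_nonneg h4.le]
      have : |(max (1-t) 0)^s - 1| ≤ 1 := by rw [abs_le]; constructor <;> linarith
      nlinarith
  have hsplit : ∫ t in Ioi ε, (((1+t)^s + (max (1-t) 0)^s - 2) * t^p) =
      (∫ t in Ioi ε, fA t) + ∫ t in Ioi ε, fB t := by
    rw [← integral_add hAint hBint]
    congr 1; ext t; simp only [hfA, hfB]; ring
  -- substitution
  have himg : (fun t : ℝ => t/(1+t)) '' (Ioi ε) = Ioo δ 1 := by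
    ext τ; constructor
    · rintro ⟨t, ht, rfl⟩
      have ht' : ε < t := ht
      constructor
      · show ε/(1+ε) < t/(1+t)
        rw [div_lt_div_iff₀ (by linarith) (by linarith)]; nlinarith
      · show t/(1+t) < 1
        rw [div_lt_one (by linarith)]; linarith
    · rintro ⟨h1, h2⟩
      have h3 : 0 < 1 - τ := by linarith
      refine ⟨τ/(1-τ), ?_, ?_⟩
      · show ε < τ/(1-τ)
        rw [lt_div_iff₀ h3]
        rw [hδ, div_lt_iff₀ (by linarith)] at h1
        nlinarith
      · show τ/(1-τ)/(1+τ/(1-τ)) = τ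
        have : 1 + τ/(1-τ) = 1/(1-τ) := by field_simp; ring
        rw [this]; field_simp
  have hder : ∀ x ∈ Ioi ε, HasDerivWithinAt (fun t : ℝ => t/(1+t)) (1/(1+x)^2) (Ioi ε) x := by
    intro x hx
    have hx' : ε < x := hx
    have h1 : (1 + x) ≠ 0 := by linarith
    have := ((hasDerivAt_id x).div ((hasDerivAt_id x).const_add 1) h1)
    apply HasDerivAt.hasDerivWithinAt
    refine HasDerivAt.congr_deriv (f := fun t : ℝ => t/(1+t)) this ?_
    simp
  have hinj : InjOn (fun t : ℝ => t/(1+t)) (Ioi ε) := by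
    intro a ha b hb hab
    have ha' : ε < a := ha
    have hb' : ε < b := hb
    have h1 : (1 + a) ≠ 0 := by linarith
    have h2 : (1 + b) ≠ 0 := by linarith
    have hab : a/(1+a) = b/(1+b) := hab
    rw [div_eq_div_iff h1 h2] at hab
    linarith
  have hpt : ∀ x ∈ Ioi ε, |1/(1+x)^2| • J1 (x/(1+x)) = fA x := by
    intro x hx
    have hx' : ε < x := hx
    have hx0 : 0 < x := he.trans hx'
    have h1 : 0 < 1 + x := by linarith
    have e1 : 1 - x/(1+x) = (1+x)⁻¹ := by field_simp; ring
    rw [abs_of_pos (by positivity), smul_eq_mul]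
    simp only [hJ1, hfA]
    rw [e1, Real.inv_rpow h1.le, Real.inv_rpow h1.le, Real.div_rpow hx0.le h1.le, ← Real.rpow_neg h1.le,
      ← Real.rpow_neg h1.le, div_eq_mul_inv (x^p), ← Real.rpow_neg h1.le p]
    have e2 : 1/(1+x)^2 = (1+x)^(-2:ℝ) := by
      rw [Real.rpow_neg h1.le]; norm_num
    rw [e2]
    have e3 : (1+x)^(-2:ℝ) * (1+x)^(-(s-1)) * (1+x)^(-p) = (1+x)^s := by
      rw [← Real.rpow_add h1, ← Real.rpow_add h1]; congr 1; rw [hp]; ring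
    have e4 : (1+x)^(-s) * (1+x)^s = 1 := by
      rw [← Real.rpow_add h1]; simp
    calc _ = (1 - (1+x)^(-s)) * x^p * ((1+x)^(-2:ℝ) * (1+x)^(-(s-1)) * (1+x)^(-p)) := by ring
      _ = ((1+x)^s - (1+x)^(-s) * (1+x)^s) * x^p := by rw [e3]; ring
      _ = _ := by rw [e4]
  have hAJ : ∫ t in Ioi ε, fA t = ∫ τ in Ioo δ 1, J1 τ := by
    rw [← himg, integral_image_eq_integral_abs_deriv_smul measurableSet_Ioi hder hinj]
    exact (setIntegral_congr_fun measurableSet_Ioi hpt).symm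
  have hJ1int : IntegrableOn J1 (Ioo δ 1) := by
    rw [← himg, integrableOn_image_iff_integrableOn_abs_deriv_smul measurableSet_Ioi hder hinj]
    exact (integrableOn_congr_fun hpt measurableSet_Ioi).2 hAint
  -- second part
  have hε1 : ε < 1 := by linarith
  have hBsplit : ∫ t in Ioi ε, fB t = (∫ t in Ioc ε 1, J2 t) - 1/(2*s) := by
    rw [← Ioc_union_Ioi_eq_Ioi hε1.le, setIntegral_union (Ioc_disjoint_Ioi le_rfl) measurableSet_Ioi
      (hBint.mono_set Ioc_subset_Ioi_self) (hBint.mono_set (Ioi_subset_Ioi hε1.le))]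
    have e1 : ∫ t in Ioc ε 1, fB t = ∫ t in Ioc ε 1, J2 t := by
      apply setIntegral_congr_fun measurableSet_Ioc
      intro t ht
      simp only [hfB, hJ2]
      rw [max_eq_left (by linarith [ht.2])]
    have e2 : ∫ t in Ioi (1:ℝ), fB t = ∫ t in Ioi (1:ℝ), -(t^p) := by
      apply setIntegral_congr_fun measurableSet_Ioi
      intro t ht
      have : (1:ℝ) < t := ht
      simp only [hfB]
      rw [max_eq_right (by linarith), Real.zero_rpow hs0.ne']; ring
    rw [e1, e2, integral_neg, integral_Ioi_rpow_of_lt (by linarith) one_pos, Real.one_rpow]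
    rw [hp]
    have : (-1 - 2*s + 1) = -(2*s) := by ring
    rw [this]
    rw [neg_div_neg_eq]; ring
  have hJ2int : IntegrableOn J2 (Ioc ε 1) := by
    refine (integrableOn_congr_fun ?_ measurableSet_Ioc).1 (hBint.mono_set (Ioc_subset_Ioi_self : Ioc ε 1 ⊆ Ioi ε))
    intro t ht
    simp only [hfB, hJ2]
    rw [max_eq_left (by linarith [ht.2])]
  -- H
  set H : ℝ → ℝ := fun τ => (1-(1-τ)^s)^2 * τ^(-2*s)/(2*s) with hH
  have hHcont : ContinuousOn H (Icc ε 1) := by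
    simp only [hH]
    apply ContinuousOn.div_const
    apply ContinuousOn.mul
    · apply ContinuousOn.pow
      apply ContinuousOn.sub continuousOn_const
      apply ContinuousOn.rpow_const
      · fun_prop
      · intro x hx; right; exact hs0.le
    · apply ContinuousOn.rpow_const
      · fun_prop
      · intro x hx; left; linarith [hx.1]
  have hHder : ∀ x ∈ Ioo ε 1, HasDerivAt H (J1 x + J2 x) x := by
    intro x hx
    have hx0 : 0 < x := he.trans hx.1
    have hq : 0 < 1 - x := by linarith [hx.2]
    have d1 : HasDerivAt (fun τ : ℝ => 1 - (1-τ)^s) (s * (1-x)^(s-1)) x := by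
      have := (((hasDerivAt_id x).const_sub 1).rpow_const (p := s) (Or.inl hq.ne')).const_sub 1
      refine HasDerivAt.congr_deriv (f := fun τ : ℝ => 1 - (1-τ)^s) this ?_
      simp
    have d2 : HasDerivAt (fun τ : ℝ => τ^(-2*s)) ((-2*s) * x^(-2*s-1)) x :=
      Real.hasDerivAt_rpow_const (Or.inl hx0.ne')
    have d3 := ((d1.pow 2).mul d2).div_const (2*s)
    refine HasDerivAt.congr_deriv (f := H) d3 ?_
    have e1 : x^(-2*s-1) = x^p := by congr 1; rw [hp]; ring
    have e2 : x^(-2*s) = x^p * x := by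
      rw [← Real.rpow_add_one hx0.ne']; congr 1; rw [hp]; ring
    have e3 : (1-x)^s = (1-x)^(s-1) * (1-x) := by
      rw [← Real.rpow_add_one hq.ne']; congr 1; ring
    simp only [hJ1, hJ2, Pi.pow_apply]
    rw [e1, e2, e3]
    field_simp
    ring
  have hJ1nn : ∀ x ∈ Ioo δ 1, 0 ≤ J1 x := by
    intro x hx
    have hx0 : 0 < x := hδ0.trans hx.1
    have hq : 0 < 1 - x := by linarith [hx.2]
    simp only [hJ1]
    have : (1-x)^s ≤ 1 := Real.rpow_le_one hq.le (by linarith) hs0.le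
    have : 0 < (1-x)^(s-1) := Real.rpow_pos_of_pos hq _
    have : 0 < x^p := Real.rpow_pos_of_pos hx0 _
    have : 0 ≤ 1 - (1-x)^s := by linarith
    positivity
  have hJ1int' : IntegrableOn J1 (Ioc ε 1) := by
    rw [integrableOn_Ioc_iff_integrableOn_Ioo]
    exact hJ1int.mono_set (Ioo_subset_Ioo_left hδε)
  have hFTC : (∫ t in Ioc ε 1, J1 t) + ∫ t in Ioc ε 1, J2 t = 1/(2*s) - H ε := by
    rw [← integral_add hJ1int' hJ2int, ← intervalIntegral.integral_of_le hε1.le,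
      intervalIntegral.integral_eq_sub_of_hasDerivAt_of_le hε1.le hHcont hHder]
    · congr 1
      simp only [hH]
      simp [Real.zero_rpow hs0.ne']
    · rw [intervalIntegrable_iff_integrableOn_Ioc_of_le hε1.le]
      exact hJ1int'.add hJ2int
  have hJsplit : ∫ τ in Ioo δ 1, J1 τ = (∫ τ in Ioc δ ε, J1 τ) + ∫ τ in Ioc ε 1, J1 τ := by
    rw [integral_Ioc_eq_integral_Ioo (x := ε) (y := 1), ← Ioc_union_Ioo_eq_Ioo hδε hε1, setIntegral_union]
    · rw [Set.disjoint_left]; intro a ha hb; exact absurd ha.2 (not_le.2 hb.1)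
    · exact measurableSet_Ioo
    · exact hJ1int.mono_set (fun x hx => ⟨hx.1, lt_of_le_of_lt hx.2 hε1⟩)
    · exact hJ1int.mono_set (Ioo_subset_Ioo_left hδε)
  have hR : |∫ τ in Ioc δ ε, J1 τ| ≤ (2 * ε * (ε/2)^p) * (ε - δ) := by
    have := norm_setIntegral_le_of_norm_le_const (μ := volume) (s := Ioc δ ε) (f := J1) (C := 2 * ε * (ε/2)^p) (by simp) ?_
    · rw [Real.norm_eq_abs] at this
      refine this.trans (le_of_eq ?_)
      rw [Measure.real, Real.volume_Ioc, ENNReal.toReal_ofReal (by linarith)]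
    · intro x hx
      rw [Real.norm_eq_abs, abs_of_nonneg (hJ1nn x ⟨hx.1, lt_of_le_of_lt hx.2 hε1⟩)]
      have hx0 : 0 < x := hδ0.trans hx.1
      have hx2 := hx.2
      have hq : 0 < 1 - x := by linarith
      have a1 : 1 - (1-x)^s ≤ ε := by
        have : (1-x)^(1:ℝ) ≤ (1-x)^s := Real.rpow_le_rpow_of_exponent_ge hq (by linarith) hs1.le
        rw [Real.rpow_one] at this; linarith
      have a1' : 0 ≤ 1 - (1-x)^s := by
        have : (1-x)^s ≤ 1 := Real.rpow_le_one hq.le (by linarith) hs0.le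
        linarith
      have a2 : (1-x)^(s-1) ≤ 2 := by
        have h1 : (1-x)^(s-1) ≤ (1/2:ℝ)^(s-1) :=
          Real.rpow_le_rpow_of_nonpos (by norm_num) (by linarith) (by linarith)
        have h2 : (1/2:ℝ)^(s-1) ≤ (1/2:ℝ)^(-1:ℝ) :=
          Real.rpow_le_rpow_of_exponent_ge (by norm_num) (by norm_num) (by linarith)
        have h3 : (1/2:ℝ)^(-1:ℝ) = 2 := by rw [Real.rpow_neg_one]; norm_num
        linarith
      have a3 : x^p ≤ (ε/2)^p :=
        Real.rpow_le_rpow_of_nonpos (by linarith) (by linarith [hx.1]) (by linarith)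
      have b1 : 0 < (1-x)^(s-1) := Real.rpow_pos_of_pos hq _
      have b2 : 0 < x^p := Real.rpow_pos_of_pos hx0 _
      simp only [hJ1]
      calc (1-(1-x)^s)*(1-x)^(s-1)*x^p ≤ ε * 2 * (ε/2)^p := by gcongr
        _ = _ := by ring
  have hHε : 0 ≤ H ε ∧ H ε ≤ ε^2*ε^(-2*s)/(2*s) := by
    have hq : 0 < 1 - ε := by linarith
    have a1 : 1 - (1-ε)^s ≤ ε := by
      have : (1-ε)^(1:ℝ) ≤ (1-ε)^s := Real.rpow_le_rpow_of_exponent_ge hq (by linarith) hs1.le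
      rw [Real.rpow_one] at this; linarith
    have a1' : 0 ≤ 1 - (1-ε)^s := by
      have : (1-ε)^s ≤ 1 := Real.rpow_le_one hq.le (by linarith) hs0.le
      linarith
    simp only [hH]
    have b2 : 0 < ε^(-2*s) := Real.rpow_pos_of_pos he _
    constructor
    · positivity
    · gcongr
  rw [hsplit, hAJ, hJsplit, hBsplit]
  have : (∫ τ in Ioc δ ε, J1 τ) + (∫ τ in Ioc ε 1, J1 τ) + ((∫ t in Ioc ε 1, J2 t) - 1/(2*s)) =
      (∫ τ in Ioc δ ε, J1 τ) - H ε := by linarith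
  rw [this]
  have b3 : 0 < (ε/2)^p := Real.rpow_pos_of_pos (by linarith) _
  have hfin : (2 * ε * (ε/2)^p) * (ε - δ) ≤ 2 * ε^3 * (ε/2)^p := by
    calc (2 * ε * (ε/2)^p) * (ε - δ) ≤ (2 * ε * (ε/2)^p) * ε^2 := by gcongr
      _ = _ := by ring
  calc |(∫ τ in Ioc δ ε, J1 τ) - H ε| ≤ |∫ τ in Ioc δ ε, J1 τ| + |H ε| := abs_sub _ _
    _ ≤ _ := by rw [abs_of_nonneg hHε.1]; linarith [hHε.2]

lemma oneD (s : ℝ) (hs0 : 0 < s) (hs1 : s < 1) :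
    ∫ t in Ioi (0:ℝ), (((1+t)^s + (max (1-t) 0)^s - 2) * t^(-1-2*s)) = 0 := by
  by_cases hint : IntegrableOn (fun t : ℝ => ((1+t)^s + (max (1-t) 0)^s - 2) * t^(-1-2*s)) (Ioi 0)
  swap
  · exact integral_undef hint
  have hc := aecover_Ioi_of_Ioi (μ := (volume : Measure ℝ)) (A := (0:ℝ)) (a := fun x : ℝ => x)
    (l := nhdsWithin 0 (Ioi 0)) (nhdsWithin_le_nhds)
  have ht := hc.integral_tendsto_of_countably_generated hint
  refine tendsto_nhds_unique ht ?_
  rw [tendsto_zero_iff_abs_tendsto_zero]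
  have hlim : Filter.Tendsto (fun ε : ℝ => ε^(2-2*s)/(2*s) + 2*(2:ℝ)^(1+2*s) * ε^(2-2*s)) (nhdsWithin 0 (Ioi 0)) (nhds 0) := by
    have h1 : Filter.Tendsto (fun ε : ℝ => ε^(2-2*s)) (nhdsWithin 0 (Ioi 0)) (nhds 0) := by
      have : ContinuousAt (fun ε : ℝ => ε^(2-2*s)) 0 := Real.continuousAt_rpow_const _ _ (Or.inr (by linarith))
      have h2 := this.tendsto
      simp only [Real.zero_rpow (by linarith : 2-2*s ≠ 0)] at h2
      exact h2.mono_left nhdsWithin_le_nhds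
    have := (h1.div_const (2*s)).add (h1.const_mul (2*(2:ℝ)^(1+2*s)))
    simpa using this
  refine squeeze_zero' (Filter.Eventually.of_forall fun _ => abs_nonneg _) ?_ hlim
  have hmem : Ioc (0:ℝ) (1/2) ∈ nhdsWithin (0:ℝ) (Ioi 0) := Ioc_mem_nhdsGT (by norm_num)
  filter_upwards [hmem] with ε hε
  have h := oneD_eps s hs0 hs1 ε hε.1 hε.2
  have hrr : (volume.restrict (Ioi (0:ℝ))).restrict (Ioi ε) = volume.restrict (Ioi ε) := by
    rw [Measure.restrict_restrict measurableSet_Ioi, inter_eq_left.2 (Ioi_subset_Ioi hε.1.le)]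
  simp only [Function.comp]
  rw [hrr]
  refine h.trans (le_of_eq ?_)
  have he := hε.1
  have e1 : ε^2 * ε^(-2*s) = ε^(2-2*s) := by
    rw [← Real.rpow_natCast, ← Real.rpow_add he]; congr 1; push_cast; ring
  have e2 : 2 * ε^3 * (ε/2)^(-1-2*s) = 2*(2:ℝ)^(1+2*s) * ε^(2-2*s) := by
    rw [Real.div_rpow he.le (by norm_num), div_eq_mul_inv, ← Real.rpow_neg (by norm_num),
      show -(-1-2*s) = 1+2*s by ring]
    have : ε^3 * ε^(-1-2*s) = ε^(2-2*s) := by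
      rw [← Real.rpow_natCast, ← Real.rpow_add he]; congr 1; push_cast; ring
    rw [← this]; ring
  rw [e1, e2]


lemma polar_zero {E : Type*} [NormedAddCommGroup E] [NormedSpace ℝ E] [MeasurableSpace E]
    [BorelSpace E] [FiniteDimensional ℝ E] [Nontrivial E] (ν : Measure E) [ν.IsAddHaarMeasure] (f : E → ℝ)
    (h : ∀ θ : E, ‖θ‖ = 1 → ∫ r in Ioi (0:ℝ), r ^ (Module.finrank ℝ E - 1) * f (r • θ) = 0) :
    ∫ x, f x ∂ν = 0 := by
  by_cases hf : Integrable f ν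
  swap
  · exact integral_undef hf
  have e1 : ∫ x, f x ∂ν = ∫ x : ({(0)}ᶜ : Set E), f x ∂(ν.comap (↑)) := by
    rw [integral_subtype_comap (measurableSet_singleton _).compl f, restrict_compl_singleton]
  have mp := ν.measurePreserving_homeomorphUnitSphereProd
  have e2 : ∫ x : ({(0)}ᶜ : Set E), f x ∂(ν.comap (↑)) =
      ∫ z : sphere (0:E) 1 × Ioi (0:ℝ), f ((z.2 : ℝ) • (z.1 : E))
        ∂(ν.toSphere.prod (Measure.volumeIoiPow (Module.finrank ℝ E - 1))) := by
    rw [← mp.integral_comp (Homeomorph.measurableEmbedding _)]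
    congr 1; ext x
    rw [← homeomorphUnitSphereProd_symm_apply_coe]; simp
  have hint : Integrable (fun z : sphere (0:E) 1 × Ioi (0:ℝ) => f ((z.2 : ℝ) • (z.1 : E)))
      (ν.toSphere.prod (Measure.volumeIoiPow (Module.finrank ℝ E - 1))) := by
    rw [← mp.integrable_comp_emb (Homeomorph.measurableEmbedding _)]
    have h1 : Integrable (fun x : ({(0)}ᶜ : Set E) => f x) (ν.comap (↑)) := by
      have : IntegrableOn f ({(0)}ᶜ : Set E) ν := hf.integrableOn
      rwa [integrableOn_iff_comap_subtypeVal (measurableSet_singleton _).compl] at this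
    convert h1 using 1
    ext x
    simp only [Function.comp]
    rw [← homeomorphUnitSphereProd_symm_apply_coe]; simp
  rw [e1, e2, integral_prod _ hint]
  apply integral_eq_zero_of_ae
  refine Filter.Eventually.of_forall fun θ => ?_
  have hθ := h θ (by simp)
  simp only [Measure.volumeIoiPow, Pi.zero_apply, ENNReal.ofReal]
  rw [integral_withDensity_eq_integral_smul, integral_subtype_comap measurableSet_Ioi (fun a => Real.toNNReal (a ^ (Module.finrank ℝ E - 1)) • f (a • (θ:E)))]
  · refine Eq.trans ?_ hθ
    apply setIntegral_congr_fun measurableSet_Ioi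
    intro r hr
    have : (0:ℝ) < r := hr
    simp only [NNReal.smul_def, smul_eq_mul]
    rw [Real.coe_toNNReal _ (by positivity)]
  · exact (measurable_subtype_coe.pow_const _).real_toNNReal

lemma oneD_scaled (s : ℝ) (hs0 : 0 < s) (hs1 : s < 1) (a c : ℝ) (ha : 0 < a) :
    ∫ r in Ioi (0:ℝ), (((max (a + r*c) 0)^s + (max (a - r*c) 0)^s)/2 - (max a 0)^s) * r^(-1-2*s) = 0 := by
  wlog hc : 0 ≤ c generalizing c
  · have := this (-c) (by linarith)
    refine Eq.trans ?_ this
    congr 1; ext r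
    rw [mul_neg, ← sub_eq_add_neg, sub_neg_eq_add, add_comm ((max (a + r*c) 0)^s)]
  rcases hc.eq_or_lt with rfl | hc
  · simp
  have h := oneD s hs0 hs1
  have h2 := integral_comp_mul_left_Ioi (fun t : ℝ => ((1+t)^s + (max (1-t) 0)^s - 2) * t^(-1-2*s)) 0 (b := c/a) (by positivity)
  rw [mul_zero, h, smul_zero] at h2
  have h3 : ∫ r in Ioi (0:ℝ), (((max (a + r*c) 0)^s + (max (a - r*c) 0)^s)/2 - (max a 0)^s) * r^(-1-2*s)
     = ∫ r in Ioi (0:ℝ), (a^s/2 * (c/a)^(1+2*s)) * (((1+c/a*r)^s + (max (1-c/a*r) 0)^s - 2) * (c/a*r)^(-1-2*s)) := by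
    apply setIntegral_congr_fun measurableSet_Ioi
    intro r hr
    have hr : 0 < r := hr
    have hca : 0 < c/a := by positivity
    have e1 : max (a + r*c) 0 = a * (1 + c/a*r) := by
      rw [max_eq_left (by positivity)]; field_simp
    have e2 : max (a - r*c) 0 = a * max (1 - c/a*r) 0 := by
      rw [mul_max_of_nonneg _ _ ha.le]; congr 1
      · field_simp
      · simp
    simp only []
    rw [e1, e2, max_eq_left ha.le, Real.mul_rpow ha.le (by positivity), Real.mul_rpow ha.le (le_max_right _ _),
      Real.mul_rpow hca.le hr.le]
    have e3 : (c/a)^(1+2*s) * (c/a)^(-1-2*s) = 1 := by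
      rw [← Real.rpow_add hca]; ring_nf; simp
    calc _ = ((c/a)^(1+2*s) * (c/a)^(-1-2*s)) * ((a ^ s * (1 + c / a * r) ^ s + a ^ s * max (1 - c / a * r) 0 ^ s) / 2 - a ^ s) * r ^ (-1 - 2 * s) := by
          rw [e3]; ring
      _ = _ := by ring
  rw [h3, integral_const_mul, h2, mul_zero]

/-- The profile `(x_n)_+^s`. -/
noncomputable def profW (d : ℕ) (s : ℝ) (x : EuclideanSpace ℝ (Fin (d+1))) : ℝ :=
  (max (x (Fin.last d)) 0)^s

lemma kerOp_profW (d : ℕ) (s : ℝ) (hs0 : 0 < s) (hs1 : s < 1) (μ : EuclideanSpace ℝ (Fin (d+1)) → ℝ)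
    (x : EuclideanSpace ℝ (Fin (d+1))) (hx : 0 < x (Fin.last d)) :
    kerOp (d+1) s μ (profW d s) x = 0 := by
  unfold kerOp
  rw [polar_zero, mul_zero]
  intro θ hθ
  have h := oneD_scaled s hs0 hs1 (x (Fin.last d)) (θ (Fin.last d)) hx
  have : ∀ r ∈ Ioi (0:ℝ), r ^ (Module.finrank ℝ (EuclideanSpace ℝ (Fin (d+1))) - 1) *
      (((profW d s (x + r • θ) + profW d s (x - r • θ)) / 2 - profW d s x) * μ (‖r • θ‖⁻¹ • r • θ) /
        ‖r • θ‖ ^ (((d + 1 : ℕ) : ℝ) + 2 * s)) = μ θ * ((((max (x (Fin.last d) + r*θ (Fin.last d)) 0)^s + (max (x (Fin.last d) - r*θ (Fin.last d)) 0)^s)/2 - (max (x (Fin.last d)) 0)^s) * r^(-1-2*s)) := by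
    intro r hr
    have hr : 0 < r := hr
    have e1 : ‖r • θ‖ = r := by rw [norm_smul, hθ, mul_one, Real.norm_of_nonneg hr.le]
    have e2 : r⁻¹ • r • θ = θ := by rw [smul_smul, inv_mul_cancel₀ hr.ne', one_smul]
    rw [e1, e2]
    simp only [finrank_euclideanSpace, Fintype.card_fin, Nat.add_sub_cancel]
    unfold profW
    simp only [PiLp.add_apply, PiLp.sub_apply, PiLp.smul_apply, smul_eq_mul]
    have e3 : r^d / r^(((d+1 : ℕ):ℝ) + 2*s) = r^(-1-2*s) := by
      rw [← Real.rpow_natCast, ← Real.rpow_sub hr]; congr 1; push_cast; ring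
    rw [← e3]; ring
  rw [setIntegral_congr_fun measurableSet_Ioi this, integral_const_mul, h, mul_zero]


/-- Integrand of `kerOp`. -/
noncomputable def kerInt (d : ℕ) (s : ℝ) (μ f : EuclideanSpace ℝ (Fin (d+1)) → ℝ)
    (x : EuclideanSpace ℝ (Fin (d+1))) : EuclideanSpace ℝ (Fin (d+1)) → ℝ := fun y =>
  ((f (x + y) + f (x - y)) / 2 - f x) * μ (‖y‖⁻¹ • y) / ‖y‖ ^ (((d+1 : ℕ) : ℝ) + 2 * s)

lemma kerOp_eq (d : ℕ) (s : ℝ) (μ f : EuclideanSpace ℝ (Fin (d+1)) → ℝ)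
    (x : EuclideanSpace ℝ (Fin (d+1))) : kerOp (d+1) s μ f x = (1-s) * ∫ y, kerInt d s μ f x y := rfl

lemma int_pow (d : ℕ) (s a b : ℝ) (ha : 2*s < a) (hb : b < 2*s) :
    Integrable (fun y : EuclideanSpace ℝ (Fin (d+1)) =>
      (if ‖y‖ ≤ 1 then ‖y‖^a else ‖y‖^b) / ‖y‖ ^ (((d+1 : ℕ) : ℝ) + 2 * s)) := by
  rw [integrable_fun_norm_addHaar (volume : Measure (EuclideanSpace ℝ (Fin (d+1))))
    (f := fun r => (if r ≤ 1 then r^a else r^b) / r ^ (((d+1 : ℕ) : ℝ) + 2 * s))]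
  simp only [finrank_euclideanSpace, Fintype.card_fin, Nat.add_sub_cancel, smul_eq_mul]
  have key : ∀ r : ℝ, 0 < r → ∀ c : ℝ, r^d * (r^c / r ^ (((d+1 : ℕ) : ℝ) + 2 * s)) = r^(c-1-2*s) := by
    intro r hr c
    rw [← Real.rpow_natCast, ← Real.rpow_sub hr, ← Real.rpow_add hr]; congr 1; push_cast; ring
  rw [← Ioc_union_Ioi_eq_Ioi (zero_le_one' ℝ)]
  apply IntegrableOn.union
  · have h1 : IntegrableOn (fun r : ℝ => r^(a-1-2*s)) (Ioc 0 1) := by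
      rw [← intervalIntegrable_iff_integrableOn_Ioc_of_le zero_le_one]
      exact intervalIntegral.intervalIntegrable_rpow' (by linarith)
    refine (integrableOn_congr_fun ?_ measurableSet_Ioc).2 h1
    intro r hr
    simp only [hr.2, if_true]
    exact key r hr.1 a
  · have h1 : IntegrableOn (fun r : ℝ => r^(b-1-2*s)) (Ioi 1) :=
      integrableOn_Ioi_rpow_of_lt (by linarith) one_pos
    refine (integrableOn_congr_fun ?_ measurableSet_Ioi).2 h1
    intro r hr
    have hr : 1 < r := hr
    simp only [not_le.2 hr, if_false]
    exact key r (by linarith) b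

lemma spec_bound {d : ℕ} {lam Lam : ℝ} {μ : EuclideanSpace ℝ (Fin (d+1)) → ℝ}
    (hμ : SpecOK (d+1) lam Lam μ) {y : EuclideanSpace ℝ (Fin (d+1))} (hy : y ≠ 0) :
    lam ≤ μ (‖y‖⁻¹ • y) ∧ μ (‖y‖⁻¹ • y) ≤ Lam := by
  have : ‖(‖y‖⁻¹ • y)‖ = 1 := by
    rw [norm_smul, norm_inv, norm_norm, inv_mul_cancel₀ (norm_ne_zero_iff.2 hy)]
  exact (hμ.2 _ this).2

lemma int_of_bound {d : ℕ} {s lam Lam : ℝ} (hs0 : 0 < s) (hlam : 0 < lam) (a b : ℝ) (ha : 2*s < a) (hb : b < 2*s)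
    {μ : EuclideanSpace ℝ (Fin (d+1)) → ℝ} (hμ : SpecOK (d+1) lam Lam μ)
    {G : EuclideanSpace ℝ (Fin (d+1)) → ℝ} (hG : Measurable G) (C : ℝ)
    (hb : ∀ y, |G y| ≤ C * (if ‖y‖ ≤ 1 then ‖y‖^a else ‖y‖^b)) :
    Integrable (fun y => G y * μ (‖y‖⁻¹ • y) / ‖y‖ ^ (((d+1 : ℕ) : ℝ) + 2 * s)) := by
  refine Integrable.mono' ((int_pow d s a b ‹_› ‹_›).const_mul (C * Lam)) ?_ ?_
  · have := hμ.1
    apply Measurable.aestronglyMeasurable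
    fun_prop
  · refine Filter.Eventually.of_forall fun y => ?_
    have hN : ((d+1 : ℕ) : ℝ) + 2 * s ≠ 0 := by positivity
    by_cases hy : y = 0
    · subst hy; simp only [norm_zero, Real.zero_rpow hN, div_zero, mul_zero, le_refl]
    have h1 := spec_bound hμ hy
    have h2 : 0 < ‖y‖ ^ (((d+1 : ℕ) : ℝ) + 2 * s) := Real.rpow_pos_of_pos (norm_pos_iff.2 hy) _
    rw [Real.norm_eq_abs, abs_div, abs_mul, abs_of_pos h2, ← mul_div_assoc]
    refine div_le_div_of_nonneg_right ?_ h2.le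
    have h3 := hb y
    have h4 : |μ (‖y‖⁻¹ • y)| ≤ Lam := by rw [abs_of_pos (by linarith)]; exact h1.2
    calc |G y| * |μ (‖y‖⁻¹ • y)| ≤ (C * (if ‖y‖ ≤ 1 then ‖y‖^a else ‖y‖^b)) * Lam :=
          mul_le_mul h3 h4 (abs_nonneg _) ((abs_nonneg _).trans h3)
      _ = _ := by ring

lemma second_diff {E : Type*} [NormedAddCommGroup E] [NormedSpace ℝ E] {f : E → ℝ} {x : E}
    (hf : ContDiffAt ℝ 2 f x) : ∃ C : ℝ, ∃ ρ : ℝ, 0 < ρ ∧ 0 ≤ C ∧ ∀ y : E, ‖y‖ < ρ →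
      |(f (x+y) + f (x-y))/2 - f x| ≤ C * ‖y‖^2 := by
  have h1 : ContDiffAt ℝ 1 (fderiv ℝ f) x := hf.fderiv_right (by norm_num)
  obtain ⟨K, t, ht, hK⟩ := h1.exists_lipschitzOnWith
  have h2 : ∀ᶠ z in nhds x, DifferentiableAt ℝ f z := by
    have := hf.eventually (by simp)
    filter_upwards [this] with z hz
    exact hz.differentiableAt (by norm_num)
  obtain ⟨ρ, hρ, hball⟩ := Metric.eventually_nhds_iff_ball.1 (h2.and ht)
  have hkey : ∀ y : E, ‖y‖ < ρ → ‖f (x+y) - f x - fderiv ℝ f x y‖ ≤ K * ‖y‖ * ‖y‖ := by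
    intro y hy
    by_cases hy0 : y = 0
    · subst hy0; simp
    have hsub : ∀ z ∈ closedBall x ‖y‖, z ∈ ball x ρ := fun z hz =>
      lt_of_le_of_lt (mem_closedBall.1 hz) hy
    have := Convex.norm_image_sub_le_of_norm_hasFDerivWithin_le' (𝕜 := ℝ) (f := f) (C := K * ‖y‖)
      (s := closedBall x ‖y‖) (x := x) (y := x + y) (f' := fderiv ℝ f) (φ := fderiv ℝ f x)
      (fun z hz => (hball z (hsub z hz)).1.hasFDerivAt.hasFDerivWithinAt)
      (fun z hz => ?_) (convex_closedBall _ _) (by simp) (by simp)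
    · simpa using this
    · have h3 := hK.dist_le_mul z (hball z (hsub z hz)).2 x (hball x (mem_ball_self hρ)).2
      rw [dist_eq_norm] at h3
      refine h3.trans ?_
      gcongr
      exact mem_closedBall.1 hz
  refine ⟨K, ρ, hρ, K.2, fun y hy => ?_⟩
  have a1 := hkey y hy
  have a2 := hkey (-y) (by simpa using hy)
  rw [norm_neg, map_neg, ← sub_eq_add_neg] at a2
  rw [Real.norm_eq_abs, abs_le] at a1 a2
  rw [abs_le]
  constructor <;> nlinarith [a1.1, a1.2, a2.1, a2.2]

lemma int_general {d : ℕ} {s lam Lam : ℝ} (hs0 : 0 < s) (hs1 : s < 1) (hlam : 0 < lam)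
    {μ : EuclideanSpace ℝ (Fin (d+1)) → ℝ} (hμ : SpecOK (d+1) lam Lam μ)
    {f : EuclideanSpace ℝ (Fin (d+1)) → ℝ} (hf : Measurable f) {C : ℝ}
    (hC : ∀ z, |f z| ≤ C * (1 + ‖z‖)^(3*s/2)) {x : EuclideanSpace ℝ (Fin (d+1))}
    (hx : ContDiffAt ℝ 2 f x) : Integrable (kerInt d s μ f x) := by
  obtain ⟨K, ρ, hρ, hK0, hK⟩ := second_diff hx
  have hC0 : 0 ≤ C := by
    have := (abs_nonneg _).trans (hC 0)
    simpa using this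
  have hq : 0 ≤ 3*s/2 := by positivity
  set B : ℝ := 2 * C * (2 + ‖x‖)^(3*s/2) with hB
  have hB0 : 0 ≤ B := by positivity
  have hgrow : ∀ y, |(f (x+y) + f (x-y))/2 - f x| ≤ 2 * C * (1 + ‖x‖ + ‖y‖)^(3*s/2) := by
    intro y
    have b1 : |f (x+y)| ≤ C * (1 + ‖x‖ + ‖y‖)^(3*s/2) := by
      refine (hC _).trans ?_
      gcongr C * ?_ ^ _
      linarith [norm_add_le x y]
    have b2 : |f (x-y)| ≤ C * (1 + ‖x‖ + ‖y‖)^(3*s/2) := by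
      refine (hC _).trans ?_
      gcongr C * ?_ ^ _
      linarith [norm_sub_le x y]
    have b3 : |f x| ≤ C * (1 + ‖x‖ + ‖y‖)^(3*s/2) := by
      refine (hC _).trans ?_
      gcongr C * ?_ ^ _
      linarith [norm_nonneg y]
    rw [abs_le] at *
    constructor <;> linarith [b1.1, b1.2, b2.1, b2.2, b3.1, b3.2]
  refine int_of_bound hs0 hlam 2 (3*s/2) (by linarith) (by linarith) hμ
    (G := fun y => (f (x+y) + f (x-y))/2 - f x) (by fun_prop) (K + B + B/ρ^2) ?_
  intro y
  split_ifs with h1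
  · rw [Real.rpow_two]
    rcases lt_or_ge ‖y‖ ρ with h2 | h2
    · refine (hK y h2).trans ?_
      gcongr
      have : 0 ≤ B/ρ^2 := by positivity
      linarith
    · have b1 : |(f (x+y) + f (x-y))/2 - f x| ≤ B := by
        refine (hgrow y).trans ?_
        rw [hB]; gcongr 2 * C * ?_ ^ _
        linarith
      have b2 : B ≤ B/ρ^2 * ‖y‖^2 := by
        rw [div_mul_eq_mul_div, le_div_iff₀ (by positivity)]
        gcongr
      have : 0 ≤ (K + B) * ‖y‖^2 := by positivity
      linarith
  · have h1 : 1 < ‖y‖ := not_le.1 h1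
    refine (hgrow y).trans ?_
    have b1 : (1 + ‖x‖ + ‖y‖)^(3*s/2) ≤ (2+‖x‖)^(3*s/2) * ‖y‖^(3*s/2) := by
      rw [← Real.mul_rpow (by positivity) (by positivity)]
      gcongr
      nlinarith [norm_nonneg x]
    have b2 : 2 * C * (1 + ‖x‖ + ‖y‖)^(3*s/2) ≤ B * ‖y‖^(3*s/2) := by
      rw [hB, mul_assoc (2*C)]
      gcongr
    refine b2.trans ?_
    gcongr
    have : 0 ≤ B/ρ^2 := by positivity
    linarith


/-- Working form of viscosity supersolution in the half-space. -/
def SupSol (d : ℕ) (s lam Lam : ℝ) (v : EuclideanSpace ℝ (Fin (d+1)) → ℝ) : Prop :=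
  ∀ x : EuclideanSpace ℝ (Fin (d+1)), 0 < x (Fin.last d) → ∀ r : ℝ, 0 < r →
    ball x r ⊆ {x : EuclideanSpace ℝ (Fin (d + 1)) | 0 < x (Fin.last d)} →
    ∀ φ : EuclideanSpace ℝ (Fin (d+1)) → ℝ, ContDiffOn ℝ 2 φ (ball x r) → φ x = v x →
      (∀ y ∈ ball x r, φ y ≤ v y) →
      (∀ μ, SpecOK (d+1) lam Lam μ →
        Integrable (kerInt d s μ (fun y => if ‖y - x‖ < r then φ y else v y) x)) →
      ∀ ε : ℝ, 0 < ε → ∃ μ, SpecOK (d+1) lam Lam μ ∧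
        kerOp (d+1) s μ (fun y => if ‖y - x‖ < r then φ y else v y) x < ε

lemma specOK_const (d : ℕ) {lam Lam : ℝ} (h : lam ≤ Lam) : SpecOK (d+1) lam Lam (fun _ => lam) :=
  ⟨measurable_const, fun _ _ => ⟨rfl, le_rfl, h⟩⟩

lemma SupSol.of_viscSuper {d : ℕ} {s lam Lam : ℝ} (h : lam ≤ Lam) {v : EuclideanSpace ℝ (Fin (d+1)) → ℝ}
    (hv : ViscSuper (d+1) s lam Lam v {x : EuclideanSpace ℝ (Fin (d + 1)) | 0 < x (Fin.last d)}) :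
    SupSol d s lam Lam v := by
  intro x hx r hr hb φ hφ hφx hle _ ε hε
  by_contra hcon
  push Not at hcon
  have h1 := hv x hx r hr hb φ hφ hφx hle
  have h2 : ε ≤ Mminus (d+1) s lam Lam (fun y => if ‖y - x‖ < r then φ y else v y) x := by
    apply le_csInf
    · exact ⟨_, _, specOK_const d h, rfl⟩
    · rintro z ⟨μ, hμ, rfl⟩
      exact hcon μ hμ
  linarith

lemma kerInt_neg {d : ℕ} {s : ℝ} (μ f : EuclideanSpace ℝ (Fin (d+1)) → ℝ) (x y) :
    kerInt d s μ (fun z => - f z) x y = - kerInt d s μ f x y := by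
  unfold kerInt; ring

lemma kerOp_neg {d : ℕ} {s : ℝ} (μ f : EuclideanSpace ℝ (Fin (d+1)) → ℝ) (x) :
    kerOp (d+1) s μ (fun z => - f z) x = - kerOp (d+1) s μ f x := by
  rw [kerOp_eq, kerOp_eq]
  simp only [kerInt_neg]
  rw [integral_neg]; ring

lemma SupSol.of_viscSub {d : ℕ} {s lam Lam : ℝ} (h : lam ≤ Lam) {v : EuclideanSpace ℝ (Fin (d+1)) → ℝ}
    (hv : ViscSub (d+1) s lam Lam v {x : EuclideanSpace ℝ (Fin (d + 1)) | 0 < x (Fin.last d)}) :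
    SupSol d s lam Lam (fun x => - v x) := by
  intro x hx r hr hb φ hφ hφx hle _ ε hε
  by_contra hcon
  push Not at hcon
  have h1 := hv x hx r hr hb (fun y => - φ y) hφ.neg (by linarith) (fun y hy => by linarith [hle y hy])
  have e : (fun y => if ‖y - x‖ < r then φ y else - v y) =
      fun y => - (if ‖y - x‖ < r then - φ y else v y) := by
    ext y; split_ifs <;> simp
  have h2 : Mplus (d+1) s lam Lam (fun y => if ‖y - x‖ < r then - φ y else v y) x ≤ -ε := by
    apply csSup_le
    · exact ⟨_, _, specOK_const d h, rfl⟩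
    · rintro z ⟨μ, hμ, rfl⟩
      have := hcon μ hμ
      rw [e, kerOp_neg] at this
      linarith
  linarith

lemma kerInt_scale {d : ℕ} {s : ℝ} (μ g : EuclideanSpace ℝ (Fin (d+1)) → ℝ) (c R : ℝ) (hR : 0 < R) (x y) :
    kerInt d s μ (fun z => c * g (R • z)) x y =
      (c * R ^ (((d+1 : ℕ) : ℝ) + 2 * s)) * kerInt d s μ g (R • x) (R • y) := by
  unfold kerInt
  simp only [smul_add, smul_sub]
  have e1 : ‖R • y‖ = R * ‖y‖ := by rw [norm_smul, Real.norm_of_nonneg hR.le]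
  have e2 : (R * ‖y‖)⁻¹ • R • y = ‖y‖⁻¹ • y := by
    rw [smul_smul, mul_inv, mul_comm R⁻¹, mul_assoc, inv_mul_cancel₀ hR.ne', mul_one]
  rw [e1, e2, Real.mul_rpow hR.le (norm_nonneg y)]
  have h := Real.rpow_pos_of_pos hR (((d+1 : ℕ) : ℝ) + 2 * s)
  set Q := R ^ (((d+1 : ℕ) : ℝ) + 2 * s)
  have hQ : Q * Q⁻¹ = 1 := mul_inv_cancel₀ h.ne'
  simp only [div_eq_mul_inv, mul_inv]
  linear_combination (-(c * ((g (R • x + R • y) + g (R • x - R • y)) * 2⁻¹ - g (R • x)) * μ (‖y‖⁻¹ • y) *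
    (‖y‖ ^ (((d+1 : ℕ) : ℝ) + 2 * s))⁻¹)) * hQ

lemma SupSol.scale {d : ℕ} {s lam Lam : ℝ} {v : EuclideanSpace ℝ (Fin (d+1)) → ℝ}
    (hv : SupSol d s lam Lam v) (c R : ℝ) (hc : 0 < c) (hR : 0 < R) :
    SupSol d s lam Lam (fun x => c * v (R • x)) := by
  intro x hx r hr hb φ hφ hφx hle hint ε hε
  set f := (fun y => if ‖y - x‖ < r then φ y else c * v (R • y)) with hf
  set f' : EuclideanSpace ℝ (Fin (d+1)) → ℝ :=
    (fun y => if ‖y - R • x‖ < R * r then c⁻¹ * φ (R⁻¹ • y) else v y) with hf'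
  have hinv : ∀ z : EuclideanSpace ℝ (Fin (d+1)), R⁻¹ • R • z = z := fun z => by
    rw [smul_smul, inv_mul_cancel₀ hR.ne', one_smul]
  have hinv' : ∀ z : EuclideanSpace ℝ (Fin (d+1)), R • R⁻¹ • z = z := fun z => by
    rw [smul_smul, mul_inv_cancel₀ hR.ne', one_smul]
  have hff : f = fun z => c * f' (R • z) := by
    ext z
    simp only [hf, hf']
    have : ‖R • z - R • x‖ < R * r ↔ ‖z - x‖ < r := by
      rw [← smul_sub, norm_smul, Real.norm_of_nonneg hR.le]
      exact mul_lt_mul_iff_right₀ hR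
    simp only [this, hinv]
    split_ifs
    · field_simp
    · rfl
  have hmem : ∀ z ∈ ball (R • x) (R * r), R⁻¹ • z ∈ ball x r := by
    intro z hz
    rw [mem_ball, dist_eq_norm] at *
    have : R⁻¹ • z - x = R⁻¹ • (z - R • x) := by rw [smul_sub, hinv]
    rw [this, norm_smul, norm_inv, Real.norm_of_nonneg hR.le, inv_mul_lt_iff₀ hR]
    exact hz
  have hI : ∀ μ, kerInt d s μ f x = fun y =>
      (c * R ^ (((d+1 : ℕ) : ℝ) + 2 * s)) * kerInt d s μ f' (R • x) (R • y) := by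
    intro μ; ext y; rw [hff, kerInt_scale _ _ _ _ hR]
  have hk : 0 < c * R ^ (((d+1 : ℕ) : ℝ) + 2 * s) := mul_pos hc (Real.rpow_pos_of_pos hR _)
  set k2 : ℝ := |(R ^ Module.finrank ℝ (EuclideanSpace ℝ (Fin (d+1))))⁻¹| with hk2
  have hk2p : 0 < k2 := by positivity
  have hop : ∀ μ, kerOp (d+1) s μ f x = (c * R ^ (((d+1 : ℕ) : ℝ) + 2 * s)) * k2 * kerOp (d+1) s μ f' (R • x) := by
    intro μ
    rw [kerOp_eq, kerOp_eq, hI, integral_const_mul, Measure.integral_comp_smul, smul_eq_mul]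
    ring
  have := hv (R • x) (by simpa using mul_pos hR hx) (R * r) (mul_pos hR hr) ?_ (fun y => c⁻¹ * φ (R⁻¹ • y)) ?_ ?_ ?_ ?_
    (ε / ((c * R ^ (((d+1 : ℕ) : ℝ) + 2 * s)) * k2)) (by positivity)
  · obtain ⟨μ, hμ, h⟩ := this
    refine ⟨μ, hμ, ?_⟩
    rw [hop]
    rw [lt_div_iff₀ (by positivity)] at h
    linarith
  · intro z hz
    have := hb (hmem z hz)
    simp only [mem_ofPred_eq, PiLp.smul_apply, smul_eq_mul] at this
    exact (pos_iff_pos_of_mul_pos this).1 (inv_pos.2 hR)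
  · apply ContDiffOn.mul contDiffOn_const
    refine hφ.comp (t := ball x r) (ContDiff.contDiffOn (by fun_prop)) ?_
    exact hmem
  · simp only [hinv, hφx]; field_simp
  · intro y hy
    have := hle _ (hmem y hy)
    simp only [hinv'] at this
    rw [inv_mul_le_iff₀ hc]; exact this
  · intro μ hμ
    have h := hint μ hμ
    rw [hI] at h
    have h2 := (integrable_const_mul_iff (IsUnit.mk0 _ hk.ne') _).1 h
    exact (integrable_comp_smul_iff volume _ hR.ne').1 h2

lemma profW_contDiffAt {d : ℕ} {s : ℝ} {x : EuclideanSpace ℝ (Fin (d+1))} (hx : 0 < x (Fin.last d)) :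
    ContDiffAt ℝ 2 (profW d s) x := by
  have h1 : ContDiffAt ℝ 2 (fun z : EuclideanSpace ℝ (Fin (d+1)) => (z (Fin.last d))^s) x := by
    have h0 : ContDiffAt ℝ 2 (fun z : EuclideanSpace ℝ (Fin (d+1)) => z (Fin.last d)) x := by fun_prop
    exact h0.rpow_const_of_ne hx.ne'
  refine h1.congr_of_eventuallyEq ?_
  have : ∀ᶠ z : EuclideanSpace ℝ (Fin (d+1)) in nhds x, 0 < z (Fin.last d) := by
    exact (isOpen_lt (f := fun _ => (0:ℝ)) (g := fun z : EuclideanSpace ℝ (Fin (d+1)) => z (Fin.last d))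
      continuous_const (by fun_prop)).mem_nhds hx
  filter_upwards [this] with z hz
  unfold profW
  rw [max_eq_left hz.le]

lemma profW_continuous {d : ℕ} {s : ℝ} (hs0 : 0 < s) : Continuous (profW d s) := by
  unfold profW
  apply Continuous.rpow_const (by fun_prop)
  intro x; right; exact hs0.le

lemma profW_nonneg {d : ℕ} {s : ℝ} (x) : 0 ≤ profW d s x := Real.rpow_nonneg (le_max_right _ _) _

lemma coord_le_norm {d : ℕ} (x : EuclideanSpace ℝ (Fin (d+1))) (i) : |x i| ≤ ‖x‖ := by
  have := PiLp.norm_apply_le x i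
  simpa using this

lemma profW_le {d : ℕ} {s : ℝ} (hs0 : 0 < s) (x) : profW d s x ≤ ‖x‖^s := by
  unfold profW
  apply Real.rpow_le_rpow (le_max_right _ _) _ hs0.le
  exact max_le ((le_abs_self _).trans (coord_le_norm x _)) (norm_nonneg _)

lemma profW_growth {d : ℕ} {s : ℝ} (hs0 : 0 < s) (x) : |profW d s x| ≤ 1 * (1 + ‖x‖)^(3*s/2) := by
  rw [abs_of_nonneg (profW_nonneg x), one_mul]
  refine (profW_le hs0 x).trans ?_
  calc ‖x‖^s ≤ (1+‖x‖)^s := by gcongr; linarith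
    _ ≤ _ := Real.rpow_le_rpow_of_exponent_le (by linarith [norm_nonneg x]) (by linarith)

lemma profW_int {d : ℕ} {s lam Lam : ℝ} (hs0 : 0 < s) (hs1 : s < 1) (hlam : 0 < lam)
    {μ : EuclideanSpace ℝ (Fin (d+1)) → ℝ} (hμ : SpecOK (d+1) lam Lam μ) {x} (hx : 0 < x (Fin.last d)) :
    Integrable (kerInt d s μ (profW d s) x) :=
  int_general hs0 hs1 hlam hμ (profW_continuous hs0).measurable (profW_growth hs0) (profW_contDiffAt hx)

lemma profW_integral {d : ℕ} {s : ℝ} (hs0 : 0 < s) (hs1 : s < 1)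
    (μ : EuclideanSpace ℝ (Fin (d+1)) → ℝ) {x} (hx : 0 < x (Fin.last d)) :
    ∫ y, kerInt d s μ (profW d s) x y = 0 := by
  have := kerOp_profW d s hs0 hs1 μ x hx
  rw [kerOp_eq] at this
  exact (mul_eq_zero.1 this).resolve_left (by linarith)

lemma SupSol.add_profW {d : ℕ} {s lam Lam : ℝ} (hs0 : 0 < s) (hs1 : s < 1) (hlam : 0 < lam)
    {v : EuclideanSpace ℝ (Fin (d+1)) → ℝ}
    (hv : SupSol d s lam Lam v) (m : ℝ) :
    SupSol d s lam Lam (fun x => v x + m * profW d s x) := by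
  intro x hx r hr hb φ hφ hφx hle hint ε hε
  set f := (fun y => if ‖y - x‖ < r then φ y else v y + m * profW d s y) with hf
  set f' : EuclideanSpace ℝ (Fin (d+1)) → ℝ :=
    (fun y => if ‖y - x‖ < r then φ y - m * profW d s y else v y) with hf'
  have hK : ∀ μ y, kerInt d s μ f' x y = kerInt d s μ f x y - m * kerInt d s μ (profW d s) x y := by
    intro μ y
    have : ∀ z, f' z = f z - m * profW d s z := by
      intro z; simp only [hf, hf']; split_ifs <;> ring
    unfold kerInt
    rw [this, this, this]; ring
  have hInt : ∀ μ, SpecOK (d+1) lam Lam μ → Integrable (kerInt d s μ f' x) := by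
    intro μ hμ
    have := (hint μ hμ).sub ((profW_int hs0 hs1 hlam hμ hx).const_mul m)
    exact this.congr (Filter.Eventually.of_forall fun y => (hK μ y).symm)
  have hcd : ContDiffOn ℝ 2 (profW d s) (ball x r) := fun z hz =>
    (profW_contDiffAt (hb hz)).contDiffWithinAt
  obtain ⟨μ, hμ, h⟩ := hv x hx r hr hb (fun y => φ y - m * profW d s y) (hφ.sub (contDiffOn_const.mul hcd))
    (by simp only [hφx]; ring) (fun y hy => by linarith [hle y hy]) hInt ε hε
  refine ⟨μ, hμ, lt_of_eq_of_lt ?_ h⟩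
  rw [kerOp_eq, kerOp_eq]
  congr 1
  have : ∀ y, kerInt d s μ (fun y => if ‖y - x‖ < r then φ y - m * profW d s y else v y) x y =
    kerInt d s μ f x y - m * kerInt d s μ (profW d s) x y := hK μ
  simp only [this]
  rw [integral_sub (hint μ hμ) ((profW_int hs0 hs1 hlam hμ hx).const_mul m), integral_const_mul,
    profW_integral hs0 hs1 μ hx]
  ring


noncomputable def majZ {d : ℕ} (s : ℝ) (y : EuclideanSpace ℝ (Fin (d+1))) : ℝ :=
  if ‖y‖ ≤ 1 then ‖y‖^(1+s) else ‖y‖^s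

noncomputable def constC (d : ℕ) (s Lam : ℝ) : ℝ :=
  (1 - s) * (Lam * ∫ y : EuclideanSpace ℝ (Fin (d+1)), majZ s y / ‖y‖ ^ (((d+1 : ℕ) : ℝ) + 2 * s))

lemma majZ_nonneg {d : ℕ} {s : ℝ} (y : EuclideanSpace ℝ (Fin (d+1))) : 0 ≤ majZ s y := by
  unfold majZ; split_ifs <;> positivity

lemma constC_nonneg {d : ℕ} {s Lam : ℝ} (hs1 : s < 1) (hL : 0 ≤ Lam) : 0 ≤ constC d s Lam := by
  unfold constC
  have : 0 ≤ ∫ y : EuclideanSpace ℝ (Fin (d+1)), majZ s y / ‖y‖ ^ (((d+1 : ℕ) : ℝ) + 2 * s) := by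
    apply integral_nonneg
    intro y
    have := majZ_nonneg (s := s) y
    dsimp only [Pi.zero_apply]
    positivity
  have h1 : 0 ≤ 1 - s := by linarith
  positivity

lemma kerOp_lower {d : ℕ} {s lam Lam : ℝ} (hs0 : 0 < s) (hs1 : s < 1) (hlam : 0 < lam)
    {μ : EuclideanSpace ℝ (Fin (d+1)) → ℝ} (hμ : SpecOK (d+1) lam Lam μ)
    {f : EuclideanSpace ℝ (Fin (d+1)) → ℝ} {x : EuclideanSpace ℝ (Fin (d+1))} (hx : 0 < x (Fin.last d))
    (hf : Integrable (kerInt d s μ f x)) (κ A : ℝ) (hA : 0 ≤ A)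
    (h : ∀ y, κ * ((profW d s (x+y) + profW d s (x-y))/2 - profW d s x) - A * majZ s y ≤
      (f (x+y) + f (x-y))/2 - f x) : -(A * constC d s Lam) ≤ kerOp (d+1) s μ f x := by
  have hM : Integrable (fun y : EuclideanSpace ℝ (Fin (d+1)) => majZ s y / ‖y‖ ^ (((d+1 : ℕ) : ℝ) + 2 * s)) :=
    int_pow d s (1+s) s (by linarith) (by linarith)
  have hw := profW_int hs0 hs1 hlam hμ hx
  have hN : ((d+1 : ℕ) : ℝ) + 2 * s ≠ 0 := by positivity
  have key : ∫ y, (κ * kerInt d s μ (profW d s) x y - (A * Lam) * (majZ s y / ‖y‖ ^ (((d+1 : ℕ) : ℝ) + 2 * s))) ≤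
      ∫ y, kerInt d s μ f x y := by
    refine integral_mono ((hw.const_mul κ).sub (hM.const_mul _)) hf ?_
    intro y
    dsimp only
    by_cases hy : y = 0
    · subst hy; simp only [kerInt, norm_zero, Real.zero_rpow hN, div_zero, mul_zero, sub_zero, le_refl]
    · have hb := spec_bound hμ hy
      have hp : 0 < ‖y‖ ^ (((d+1 : ℕ) : ℝ) + 2 * s) := Real.rpow_pos_of_pos (norm_pos_iff.2 hy) _
      unfold kerInt
      rw [← mul_div_assoc, ← mul_div_assoc, ← sub_div]
      gcongr
      have h1 := mul_le_mul_of_nonneg_right (h y) (hlam.le.trans hb.1)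
      have h2 : A * majZ s y * μ (‖y‖⁻¹ • y) ≤ A * majZ s y * Lam :=
        mul_le_mul_of_nonneg_left hb.2 (mul_nonneg hA (majZ_nonneg y))
      nlinarith
  rw [integral_sub (hw.const_mul κ) (hM.const_mul _), integral_const_mul, integral_const_mul,
    profW_integral hs0 hs1 μ hx, mul_zero, zero_sub] at key
  rw [kerOp_eq]
  have h1 : 0 ≤ 1 - s := by linarith
  have := mul_le_mul_of_nonneg_left key h1
  unfold constC
  linarith

noncomputable def eta {d : ℕ} (z x : EuclideanSpace ℝ (Fin (d+1))) : ℝ := max 0 (1 - ‖x - z‖^2/4)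

lemma eta_nonneg {d : ℕ} (z x : EuclideanSpace ℝ (Fin (d+1))) : 0 ≤ eta z x := le_max_left _ _

lemma eta_le_one {d : ℕ} (z x : EuclideanSpace ℝ (Fin (d+1))) : eta z x ≤ 1 := by
  apply max_le (by norm_num); nlinarith [sq_nonneg ‖x-z‖]

lemma eta_continuous {d : ℕ} (z : EuclideanSpace ℝ (Fin (d+1))) : Continuous (eta z) := by
  unfold eta; fun_prop

lemma eta_eq {d : ℕ} {z x : EuclideanSpace ℝ (Fin (d+1))} (h : 0 < eta z x) : eta z x = 1 - ‖x - z‖^2/4 := by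
  unfold eta at *
  rcases lt_max_iff.1 h with h | h
  · exact absurd h (lt_irrefl _)
  · exact max_eq_right h.le

lemma eta_near {d : ℕ} {z x : EuclideanSpace ℝ (Fin (d+1))} (h : 0 < eta z x) : ‖x - z‖ < 2 := by
  have := eta_eq h
  rw [this] at h
  nlinarith [norm_nonneg (x-z)]

lemma eta_far {d : ℕ} {z x : EuclideanSpace ℝ (Fin (d+1))} (h : 2 ≤ ‖x - z‖) : eta z x = 0 := by
  apply max_eq_left; nlinarith

lemma eta_contDiffAt {d : ℕ} {z x : EuclideanSpace ℝ (Fin (d+1))} (h : 0 < eta z x) : ContDiffAt ℝ 2 (eta z) x := by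
  have h1 : ContDiffAt ℝ 2 (fun x : EuclideanSpace ℝ (Fin (d+1)) => 1 - ‖x - z‖^2/4) x := by
    have : ContDiff ℝ 2 (fun x : EuclideanSpace ℝ (Fin (d+1)) => ‖x - z‖^2) :=
      (contDiff_id.sub contDiff_const).norm_sq ℝ
    exact (contDiff_const.sub (this.div_const 4)).contDiffAt
  refine h1.congr_of_eventuallyEq ?_
  filter_upwards [(isOpen_lt continuous_const (eta_continuous z)).mem_nhds h] with y hy
  exact eta_eq hy

lemma eta_lip {d : ℕ} (z x y : EuclideanSpace ℝ (Fin (d+1))) : |eta z x - eta z y| ≤ ‖x - y‖ := by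
  have e : ∀ x, eta z x = 1 - (min ‖x - z‖ 2)^2/4 := by
    intro x
    rcases le_total ‖x-z‖ 2 with h | h
    · rw [min_eq_left h]; apply max_eq_right; nlinarith [norm_nonneg (x-z)]
    · rw [min_eq_right h, eta_far h]; norm_num
  have h1 : |min ‖x - z‖ 2 - min ‖y - z‖ 2| ≤ ‖x - y‖ := by
    refine (abs_min_sub_min_le_max _ _ _ _).trans ?_
    simp only [sub_self, abs_zero]
    apply max_le _ (norm_nonneg _)
    have := abs_norm_sub_norm_le (x-z) (y-z)
    simpa using this
  have hx0 : 0 ≤ min ‖x - z‖ 2 := by positivity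
  have hy0 : 0 ≤ min ‖y - z‖ 2 := by positivity
  have hx2 : min ‖x - z‖ 2 ≤ 2 := min_le_right _ _
  have hy2 : min ‖y - z‖ 2 ≤ 2 := min_le_right _ _
  rw [e, e]
  rw [abs_le] at *
  constructor <;> nlinarith [norm_nonneg (x-y)]

lemma eta_second {d : ℕ} {s : ℝ} (hs0 : 0 < s) (hs1 : s < 1) {z x : EuclideanSpace ℝ (Fin (d+1))} (h : 0 < eta z x) (y) :
    -(majZ s y) ≤ (eta z (x+y) + eta z (x-y))/2 - eta z x := by
  unfold majZ
  split_ifs with hy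
  · have h1 : 1 - ‖x + y - z‖^2/4 ≤ eta z (x+y) := le_max_right _ _
    have h2 : 1 - ‖x - y - z‖^2/4 ≤ eta z (x-y) := le_max_right _ _
    rw [eta_eq h]
    have h3 := parallelogram_law_with_norm ℝ (x - z) y
    have e1 : x - z + y = x + y - z := by abel
    have e2 : x - z - y = x - y - z := by abel
    rw [e1, e2] at h3
    have h4 : ‖y‖^2 ≤ ‖y‖^(1+s) := by
      rcases (norm_nonneg y).eq_or_lt with h0 | h0
      · rw [← h0]; simp; positivity
      · rw [← Real.rpow_natCast]
        apply Real.rpow_le_rpow_of_exponent_ge h0 hy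
        push_cast; linarith
    nlinarith [sq_nonneg ‖y‖]
  · have h1 := eta_le_one z x
    have h2 := eta_nonneg z (x+y)
    have h3 := eta_nonneg z (x-y)
    have : 1 ≤ ‖y‖^s := Real.one_le_rpow (by linarith) hs0.le
    linarith

lemma profW_holder {d : ℕ} {s : ℝ} (hs0 : 0 < s) (hs1 : s < 1) (x y : EuclideanSpace ℝ (Fin (d+1))) :
    |profW d s x - profW d s y| ≤ ‖x - y‖^s := by
  have key : ∀ a b : ℝ, 0 ≤ a → 0 ≤ b → a^s - b^s ≤ |a - b|^s := by
    intro a b ha hb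
    rcases le_total a b with h | h
    · have h1 : a^s ≤ b^s := by gcongr
      have h2 : 0 ≤ |a-b|^s := by positivity
      linarith
    · rw [abs_of_nonneg (by linarith)]
      have := Real.rpow_add_le_add_rpow (p := s) (sub_nonneg.2 h) hb hs0.le hs1.le
      rw [sub_add_cancel] at this
      linarith
  have hm : |max (x (Fin.last d)) 0 - max (y (Fin.last d)) 0| ≤ ‖x - y‖ := by
    refine (abs_max_sub_max_le_max _ _ _ _).trans ?_
    simp only [sub_self, abs_zero]
    exact max_le (coord_le_norm (x-y) (Fin.last d)) (norm_nonneg _)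
  have h2 : |max (x (Fin.last d)) 0 - max (y (Fin.last d)) 0|^s ≤ ‖x-y‖^s := by gcongr
  unfold profW
  rw [abs_le]
  have k1 := key _ _ (le_max_right (x (Fin.last d)) 0) (le_max_right (y (Fin.last d)) 0)
  have k2 := key _ _ (le_max_right (y (Fin.last d)) 0) (le_max_right (x (Fin.last d)) 0)
  rw [abs_sub_comm] at k2
  constructor <;> linarith

lemma cross_bound {d : ℕ} {s : ℝ} (hs0 : 0 < s) (hs1 : s < 1) (z x y y' : EuclideanSpace ℝ (Fin (d+1)))
    (hy' : ‖y' - x‖ = ‖y‖) :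
    -(majZ s y) ≤ (profW d s y' - profW d s x) * (eta z y' - eta z x) := by
  have h1 := profW_holder hs0 hs1 y' x
  have h2 := eta_lip z y' x
  rw [hy'] at h1 h2
  have h3 : |eta z y' - eta z x| ≤ 1 := by
    rw [abs_le]
    have := eta_le_one z x
    have := eta_nonneg z x
    have := eta_le_one z y'
    have := eta_nonneg z y'
    constructor <;> linarith
  have h4 : |(profW d s y' - profW d s x) * (eta z y' - eta z x)| ≤ majZ s y := by
    rw [abs_mul]
    unfold majZ
    split_ifs with hy
    · rcases (norm_nonneg y).eq_or_lt with h0 | h0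
      · rw [← h0] at h2 ⊢
        have : |eta z y' - eta z x| = 0 := le_antisymm h2 (abs_nonneg _)
        rw [this, mul_zero]; positivity
      · rw [add_comm (1:ℝ) s, Real.rpow_add h0, Real.rpow_one]
        gcongr
    · calc _ ≤ ‖y‖^s * 1 := by gcongr
        _ = _ := mul_one _
  exact (abs_le.1 h4).1

lemma weta_second {d : ℕ} {s : ℝ} (hs0 : 0 < s) (hs1 : s < 1) {z x : EuclideanSpace ℝ (Fin (d+1))} (h : 0 < eta z x)
    (hx3 : ‖x‖ < 3) (y) :
    eta z x * ((profW d s (x+y) + profW d s (x-y))/2 - profW d s x) - 4 * majZ s y ≤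
     (profW d s (x+y) * eta z (x+y) + profW d s (x-y) * eta z (x-y))/2 - profW d s x * eta z x := by
  have h1 := eta_second hs0 hs1 h y
  have h2 := cross_bound hs0 hs1 z x y (x+y) (by simp)
  have h3 := cross_bound hs0 hs1 z x y (x-y) (by simp)
  have h4 : profW d s x ≤ 3 := by
    refine (profW_le hs0 x).trans ?_
    calc ‖x‖^s ≤ 3^s := by gcongr
      _ ≤ 3^(1:ℝ) := Real.rpow_le_rpow_of_exponent_le (by norm_num) hs1.le
      _ = 3 := Real.rpow_one _
  have h5 := profW_nonneg (s := s) x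
  have h6 := mul_le_mul_of_nonneg_left h1 h5
  have h7 := mul_le_mul_of_nonneg_right h4 (majZ_nonneg (s := s) y)
  nlinarith


noncomputable def cD (d : ℕ) : EuclideanSpace ℝ (Fin (d+1)) := EuclideanSpace.single (Fin.last d) (5:ℝ)

lemma cD_norm (d : ℕ) : ‖cD d‖ = 5 := by simp [cD]

lemma mem_D {d : ℕ} {z : EuclideanSpace ℝ (Fin (d+1))} (hz : z ∈ ball (cD d) 1) : 4 < ‖z‖ ∧ ‖z‖ < 6 := by
  rw [mem_ball, dist_eq_norm] at hz
  have h1 := abs_le.1 (abs_norm_sub_norm_le z (cD d))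
  rw [cD_norm] at h1
  constructor <;> linarith

lemma profW_D {d : ℕ} {s : ℝ} (hs0 : 0 < s) {z : EuclideanSpace ℝ (Fin (d+1))} (hz : z ∈ ball (cD d) 1) : 1 ≤ profW d s z := by
  rw [mem_ball, dist_eq_norm] at hz
  have h1 := coord_le_norm (z - cD d) (Fin.last d)
  have h2 : (z - cD d) (Fin.last d) = z (Fin.last d) - 5 := by simp [cD]
  rw [h2] at h1
  have h3 := (abs_le.1 h1).1
  unfold profW
  apply Real.one_le_rpow _ hs0.le
  apply le_max_of_le_left
  linarith

noncomputable def tailT (d : ℕ) (s : ℝ) (z : EuclideanSpace ℝ (Fin (d+1))) : ℝ :=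
  indicator {z | 8 ≤ ‖z‖} (fun z => ‖z‖^(3*s/2) / ‖z‖ ^ (((d+1 : ℕ) : ℝ) + 2 * s)) z

lemma measSet8 (d : ℕ) : MeasurableSet {z : EuclideanSpace ℝ (Fin (d+1)) | 8 ≤ ‖z‖} :=
  measurableSet_le measurable_const measurable_norm

lemma tailT_int (d : ℕ) {s : ℝ} (hs0 : 0 < s) : Integrable (tailT d s) := by
  have h := int_pow d s (2*s+1) (3*s/2) (by linarith) (by linarith)
  refine Integrable.congr (h.indicator (measSet8 d)) ?_
  refine Filter.Eventually.of_forall fun z => ?_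
  unfold tailT
  by_cases hz : 8 ≤ ‖z‖
  · rw [indicator_of_mem (by exact hz), indicator_of_mem (by exact hz), if_neg (by linarith)]
  · rw [indicator_of_notMem (by exact hz), indicator_of_notMem (by exact hz)]

lemma tailT_nonneg {d : ℕ} {s : ℝ} (z) : 0 ≤ tailT d s z := by
  unfold tailT
  apply indicator_nonneg
  intro z _; positivity

lemma point_bound {d : ℕ} {s lam Lam : ℝ} (hs0 : 0 < s) (hlam : 0 < lam) (hlL : lam ≤ Lam)
    {x0 z : EuclideanSpace ℝ (Fin (d+1))} (hx3 : ‖x0‖ < 3) (hz : z ≠ x0) {k : ℝ}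
    (hk1 : lam ≤ k) (hk2 : k ≤ Lam) {H Fz σ : ℝ} (hσ : 0 ≤ σ) (hH0 : ‖z‖ < 8 → 0 ≤ H)
    (hHD : z ∈ ball (cD d) 1 → H = Fz) (hH8 : 8 ≤ ‖z‖ → -(σ * ‖z‖^(3*s/2)) ≤ H) :
    (lam / 16 ^ (((d+1 : ℕ) : ℝ) + 2 * s)) * indicator (ball (cD d) 1) (fun _ => Fz) z -
      (σ * (Lam * 2 ^ (((d+1 : ℕ) : ℝ) + 2 * s))) * tailT d s z ≤ H * k / ‖z - x0‖ ^ (((d+1 : ℕ) : ℝ) + 2 * s) := by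
  have hN : 0 < ((d+1 : ℕ) : ℝ) + 2 * s := by positivity
  set N := ((d+1 : ℕ) : ℝ) + 2 * s with hNdef
  have hp : 0 < ‖z - x0‖ := norm_pos_iff.2 (sub_ne_zero.2 hz)
  by_cases h8 : 8 ≤ ‖z‖
  · have hD : z ∉ ball (cD d) 1 := fun h => by linarith [(mem_D h).2]
    rw [indicator_of_notMem hD, tailT, indicator_of_mem (by exact h8), ← hNdef, mul_zero, zero_sub]
    have h1 : ‖z‖/2 ≤ ‖z - x0‖ := by linarith [norm_sub_norm_le z x0]
    have hz0 : 0 < ‖z‖ := by linarith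
    have h2 : (‖z‖/2)^N ≤ ‖z-x0‖^N := by gcongr
    rw [Real.div_rpow hz0.le (by norm_num)] at h2
    have h3 := hH8 h8
    have hk0 : 0 ≤ k := hlam.le.trans hk1
    have hA : 0 ≤ σ * ‖z‖^(3*s/2) := by positivity
    have hzN : 0 < ‖z‖^N := Real.rpow_pos_of_pos hz0 _
    have h2N : 0 < (2:ℝ)^N := Real.rpow_pos_of_pos (by norm_num) _
    have hL : 0 ≤ Lam := by linarith
    calc _ = -((σ * ‖z‖^(3*s/2)) * Lam / (‖z‖^N/2^N)) := by field_simp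
      _ ≤ -((σ * ‖z‖^(3*s/2)) * k / ‖z-x0‖^N) := by gcongr
      _ = (-(σ * ‖z‖^(3*s/2))) * k / ‖z-x0‖^N := by ring
      _ ≤ _ := by gcongr
  · have h8' : ‖z‖ < 8 := not_le.1 h8
    have ht : tailT d s z = 0 := indicator_of_notMem (by exact h8) _
    rw [ht, mul_zero, sub_zero]
    have hH := hH0 h8'
    by_cases hD : z ∈ ball (cD d) 1
    · rw [indicator_of_mem hD, ← hHD hD]
      have h1 : ‖z - x0‖ ≤ 16 := by linarith [norm_sub_le z x0]
      have hpN : 0 < ‖z - x0‖^N := Real.rpow_pos_of_pos hp _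
      calc _ = H * lam / 16^N := by ring
        _ ≤ _ := by
          gcongr
          exact mul_nonneg hH (hlam.le.trans hk1)
    · rw [indicator_of_notMem hD, mul_zero]
      have hk0 : 0 ≤ k := hlam.le.trans hk1
      positivity

lemma touch (d : ℕ) {s lam Lam : ℝ} (hs0 : 0 < s) (hs1 : s < 1) (hlam : 0 < lam) (hlL : lam ≤ Lam) :
    ∃ c1 C2 : ℝ, 0 < c1 ∧ 0 ≤ C2 ∧ ∀ (v g : EuclideanSpace ℝ (Fin (d+1)) → ℝ)
      (x0 : EuclideanSpace ℝ (Fin (d+1))) (a m σ Cv Cg : ℝ), Continuous v → Continuous g →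
      SupSol d s lam Lam v → 0 < x0 (Fin.last d) → ‖x0‖ < 3 → ContDiffAt ℝ 2 g x0 →
      (∀ μ, SpecOK (d+1) lam Lam μ → Integrable (kerInt d s μ g x0) → -a ≤ kerOp (d+1) s μ g x0) →
      g x0 = v x0 + m → (∀ z, ‖z‖ < 8 → 0 ≤ v z - g z + m) →
      (∀ z, 8 ≤ ‖z‖ → -(σ * ‖z‖^(3*s/2)) ≤ v z - g z + m) → 0 ≤ σ →
      (∀ z, |v z| ≤ Cv * (1 + ‖z‖)^(3*s/2)) → (∀ z, |g z| ≤ Cg * (1 + ‖z‖)^(3*s/2)) →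
      c1 * ∫ z in ball (cD d) 1, (v z - g z + m) ≤ a + C2 * σ := by
  have h1s : 0 < 1 - s := by linarith
  have hL : 0 < Lam := by linarith
  set N := ((d+1 : ℕ) : ℝ) + 2 * s with hNdef
  refine ⟨(1-s) * (lam / 16^N), (1-s) * (Lam * 2^N * ∫ z, tailT d s z), by positivity, ?_, ?_⟩
  · have := integral_nonneg (μ := volume) (f := tailT d s) (fun z => tailT_nonneg (d := d) (s := s) z)
    positivity
  intro v g x0 a m σ Cv Cg hv hg hsup hx0 hx3 hgC hgop hgv h8 htail hσ hCv hCg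
  -- choose the radius
  obtain ⟨r, hr, hr1, hball⟩ : ∃ r : ℝ, 0 < r ∧ r ≤ 1 ∧ ∀ z ∈ ball x0 r, ContDiffAt ℝ 2 g z ∧ 0 < z (Fin.last d) := by
    have e1 := hgC.eventually (by simp)
    have e2 : ∀ᶠ z : EuclideanSpace ℝ (Fin (d+1)) in nhds x0, 0 < z (Fin.last d) :=
      (isOpen_lt (f := fun _ => (0:ℝ)) (g := fun z : EuclideanSpace ℝ (Fin (d+1)) => z (Fin.last d))
      continuous_const (by fun_prop)).mem_nhds hx0
    obtain ⟨r, hr, h⟩ := Metric.eventually_nhds_iff_ball.1 (e1.and e2)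
    exact ⟨min r 1, by positivity, min_le_right _ _, fun z hz => h z (ball_subset_ball (min_le_left _ _) hz)⟩
  set F : EuclideanSpace ℝ (Fin (d+1)) → ℝ := fun z => v z - g z + m with hF
  set h : EuclideanSpace ℝ (Fin (d+1)) → ℝ := fun z => if ‖z - x0‖ < r then 0 else F z with hh
  have hsmall : ∀ z, ‖z - x0‖ < r → ‖z‖ < 4 := fun z hz => by
    linarith [norm_sub_norm_le z x0]
  have hh0 : h x0 = 0 := by simp [hh, hr]
  have hFc : Continuous F := by fun_prop
  have hhm : Measurable h := by
    apply Measurable.ite _ measurable_const hFc.measurable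
    exact measurableSet_lt (by fun_prop) measurable_const
  have hgrow : ∀ z, |h z| ≤ (Cv + Cg + |m|) * (1 + ‖z‖)^(3*s/2) := by
    intro z
    have hone : 1 ≤ (1 + ‖z‖)^(3*s/2) := Real.one_le_rpow (by linarith [norm_nonneg z]) (by positivity)
    have b1 := hCv z
    have b2 := hCg z
    have b3 : |m| ≤ |m| * (1 + ‖z‖)^(3*s/2) := le_mul_of_one_le_right (abs_nonneg _) hone
    have b4 : 0 ≤ |m| := abs_nonneg _
    simp only [hh, hF]
    split_ifs
    · rw [abs_zero]; linarith [abs_nonneg (v z), abs_nonneg (g z)]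
    · have : |v z - g z + m| ≤ |v z| + |g z| + |m| := (abs_add_le _ _).trans (by gcongr; exact abs_sub _ _)
      linarith
  have hhC : ContDiffAt ℝ 2 h x0 := by
    refine (contDiffAt_const (c := (0:ℝ))).congr_of_eventuallyEq ?_
    filter_upwards [ball_mem_nhds x0 hr] with z hz
    rw [mem_ball, dist_eq_norm] at hz
    simp [hh, hz]
  have hfe : ∀ z, (if ‖z - x0‖ < r then g z - m else v z) = (g z - m) + h z := by
    intro z; simp only [hh, hF]; split_ifs <;> ring
  have hK : ∀ μ y, kerInt d s μ (fun z => if ‖z - x0‖ < r then g z - m else v z) x0 y =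
      kerInt d s μ g x0 y + kerInt d s μ h x0 y := by
    intro μ y
    simp only [hfe]
    unfold kerInt; ring
  have hIg : ∀ μ, SpecOK (d+1) lam Lam μ → Integrable (kerInt d s μ g x0) := fun μ hμ =>
    int_general hs0 hs1 hlam hμ hg.measurable hCg hgC
  have hIh : ∀ μ, SpecOK (d+1) lam Lam μ → Integrable (kerInt d s μ h x0) := fun μ hμ =>
    int_general hs0 hs1 hlam hμ hhm hgrow hhC
  by_contra hcon
  push Not at hcon
  obtain ⟨μ, hμ, hlt⟩ := hsup x0 hx0 r hr (fun z hz => (hball z hz).2) (fun z => g z - m)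
    (fun z hz => ((hball z hz).1.sub contDiffAt_const).contDiffWithinAt) (by linarith)
    (fun z hz => by
      have : ‖z‖ < 4 := hsmall z (by rwa [mem_ball, dist_eq_norm] at hz)
      linarith [h8 z (by linarith)])
    (fun μ hμ => ((hIg μ hμ).add (hIh μ hμ)).congr (Filter.Eventually.of_forall fun y => (hK μ y).symm))
    _ (sub_pos.2 hcon)
  rw [kerOp_eq] at hlt
  simp only [hK] at hlt
  rw [integral_add (hIg μ hμ) (hIh μ hμ), mul_add, ← kerOp_eq] at hlt
  have hglow := hgop μ hμ (hIg μ hμ)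
  -- lower bound for the h part
  set Q : EuclideanSpace ℝ (Fin (d+1)) → ℝ := fun z =>
    (lam / 16^N) * indicator (ball (cD d) 1) F z - (σ * (Lam * 2^N)) * tailT d s z with hQ
  have hID : Integrable (indicator (ball (cD d) 1) F) := by
    rw [integrable_indicator_iff measurableSet_ball]
    exact (hFc.continuousOn.integrableOn_compact (isCompact_closedBall (cD d) 1)).mono_set ball_subset_closedBall
  have hQi : Integrable Q := (hID.const_mul _).sub ((tailT_int d hs0).const_mul _)
  have hQv : ∫ z, Q z = (lam / 16^N) * (∫ z in ball (cD d) 1, F z) - (σ * (Lam * 2^N)) * ∫ z, tailT d s z := by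
    rw [hQ, integral_sub (hID.const_mul _) ((tailT_int d hs0).const_mul _), integral_const_mul, integral_const_mul,
      integral_indicator measurableSet_ball]
  have hlow : ∫ y, (Q (x0 + y) + Q (x0 - y))/2 ≤ ∫ y, kerInt d s μ h x0 y := by
    refine integral_mono (((hQi.comp_add_left x0).add (hQi.comp_sub_left x0)).div_const 2) (hIh μ hμ) ?_
    intro y
    dsimp only
    by_cases hy : y = 0
    · subst hy
      have hNne : ((d+1 : ℕ) : ℝ) + 2 * s ≠ 0 := by positivity
      have e : Q x0 = 0 := by
        simp only [hQ]
        rw [indicator_of_notMem (fun h => by linarith [(mem_D h).1]), tailT, indicator_of_notMem (by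
          intro h; have : 8 ≤ ‖x0‖ := h; linarith)]
        ring
      simp [kerInt, hh0, e]
    · have hb := spec_bound hμ hy
      have hz : ∀ z, ‖z - x0‖ = ‖y‖ → Q z ≤ h z * μ (‖y‖⁻¹ • y) / ‖y‖^N := by
        intro z hzy
        have hzx : z ≠ x0 := by
          rintro rfl
          rw [sub_self, norm_zero] at hzy
          exact hy (norm_eq_zero.1 hzy.symm)
        have := point_bound (d := d) hs0 hlam hlL hx3 hzx hb.1 hb.2 (H := h z) (Fz := F z) hσ ?_ ?_ ?_
        · rw [hzy] at this
          refine le_trans (le_of_eq ?_) this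
          simp only [hQ]
          congr 2
        · intro h8z
          simp only [hh]; split_ifs
          · exact le_rfl
          · exact h8 z h8z
        · intro hD
          simp only [hh]; rw [if_neg]
          intro hc
          linarith [hsmall z hc, (mem_D hD).1]
        · intro h8z
          simp only [hh]; rw [if_neg]
          · exact htail z h8z
          intro hc
          linarith [hsmall z hc]
      have h1 := hz (x0 + y) (by simp)
      have h2 := hz (x0 - y) (by simp)
      calc _ ≤ (h (x0+y) * μ (‖y‖⁻¹ • y) / ‖y‖^N + h (x0-y) * μ (‖y‖⁻¹ • y) / ‖y‖^N)/2 := by linarith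
        _ = _ := by unfold kerInt; rw [hh0]; ring
  rw [integral_div, integral_add (hQi.comp_add_left x0) (hQi.comp_sub_left x0),
    integral_add_left_eq_self, integral_sub_left_eq_self, hQv] at hlow
  have := mul_le_mul_of_nonneg_left hlow h1s.le
  nlinarith


lemma volD_pos (d : ℕ) : 0 < (volume : Measure (EuclideanSpace ℝ (Fin (d+1)))).real (ball (cD d) 1) := by
  apply ENNReal.toReal_pos
  · exact (measure_ball_pos _ _ one_pos).ne'
  · exact measure_ball_lt_top.ne

lemma intD {d : ℕ} {F : EuclideanSpace ℝ (Fin (d+1)) → ℝ} (hF : Continuous F) : IntegrableOn F (ball (cD d) 1) :=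
  (hF.continuousOn.integrableOn_compact (isCompact_closedBall (cD d) 1)).mono_set ball_subset_closedBall

lemma intD_lower {d : ℕ} {F : EuclideanSpace ℝ (Fin (d+1)) → ℝ} (hF : Continuous F) (κ : ℝ)
    (h : ∀ z ∈ ball (cD d) 1, κ ≤ F z) :
    (volume : Measure (EuclideanSpace ℝ (Fin (d+1)))).real (ball (cD d) 1) * κ ≤ ∫ z in ball (cD d) 1, F z := by
  have := setIntegral_mono_on (intD (F := fun _ => κ) continuous_const) (intD hF) measurableSet_ball h
  rwa [setIntegral_const, smul_eq_mul] at this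

lemma one_le_grow {d : ℕ} {s : ℝ} (hs0 : 0 < s) (z : EuclideanSpace ℝ (Fin (d+1))) : 1 ≤ (1 + ‖z‖)^(3*s/2) :=
  Real.one_le_rpow (by linarith [norm_nonneg z]) (by positivity)

lemma profW_zero {d : ℕ} {s : ℝ} (hs0 : 0 < s) {x : EuclideanSpace ℝ (Fin (d+1))} (hx : x (Fin.last d) ≤ 0) :
    profW d s x = 0 := by
  unfold profW; rw [max_eq_right hx, Real.zero_rpow hs0.ne']

lemma profW_pos {d : ℕ} {s : ℝ} {x : EuclideanSpace ℝ (Fin (d+1))} (hx : 0 < x (Fin.last d)) :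
    0 < profW d s x := by
  unfold profW; rw [max_eq_left hx.le]; exact Real.rpow_pos_of_pos hx _

lemma lower_b (d : ℕ) {s lam Lam : ℝ} (hs0 : 0 < s) (hs1 : s < 1) (hlam : 0 < lam) (hlL : lam ≤ Lam) :
    ∃ A' : ℝ, 0 ≤ A' ∧ ∀ (v : EuclideanSpace ℝ (Fin (d+1)) → ℝ) (C : ℝ), Continuous v → SupSol d s lam Lam v →
      (∀ x, x (Fin.last d) ≤ 0 → v x = 0) →
      (∀ S : ℝ, 1 ≤ S → ∀ x, ‖x‖ < S → |v x| ≤ C * S^(3*s/2)) →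
      ∀ x, ‖x‖ < 1 → -(A' * C * profW d s x) ≤ v x := by
  obtain ⟨c1, C2, hc1, hC2, hT⟩ := touch d hs0 hs1 hlam hlL
  set C0 := constC d s Lam with hC0def
  have hC0 : 0 ≤ C0 := constC_nonneg hs1 (by linarith)
  set V := (volume : Measure (EuclideanSpace ℝ (Fin (d+1)))).real (ball (cD d) 1) with hV
  have hVp : 0 < V := volD_pos d
  set A : ℝ := (C0 + C2)/(c1 * V) with hA
  have hA0 : 0 ≤ A := by positivity
  have hAe : c1 * V * A = C0 + C2 := by rw [hA]; field_simp
  refine ⟨(A+1) * 9^(3*s/2), by positivity, ?_⟩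
  intro v C hv hsup hv0 hgr x hx1
  have hC : 0 ≤ C := by
    have := (abs_nonneg _).trans (hgr 1 le_rfl 0 (by simp))
    simpa using this
  rcases le_or_gt (x (Fin.last d)) 0 with hxn | hxn
  · rw [hv0 x hxn, profW_zero hs0 hxn]; simp
  set z : EuclideanSpace ℝ (Fin (d+1)) := x - EuclideanSpace.single (Fin.last d) (x (Fin.last d)) with hz
  have hxz : ‖x - z‖ = x (Fin.last d) := by
    rw [hz, sub_sub_cancel]; simp [abs_of_pos hxn]
  have hz1 : ‖z‖ < 1 := by
    refine lt_of_le_of_lt ?_ hx1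
    rw [← sq_le_sq₀ (norm_nonneg _) (norm_nonneg _), EuclideanSpace.norm_sq_eq, EuclideanSpace.norm_sq_eq]
    apply Finset.sum_le_sum
    intro i _
    by_cases hi : i = Fin.last d
    · subst hi; simp [hz]; positivity
    · simp [hz, hi]
  set t := C * 9^(3*s/2) with ht
  have ht0 : 0 ≤ t := by positivity
  set g : EuclideanSpace ℝ (Fin (d+1)) → ℝ := fun y => -(t*A) * profW d s y + t * eta z y - t with hg
  have hgc : Continuous g := by
    have := profW_continuous (d := d) hs0
    have := eta_continuous z
    fun_prop
  have hv9 : ∀ y, ‖y‖ ≤ 8 → -t ≤ v y := fun y hy => (abs_le.1 (hgr 9 (by norm_num) y (by linarith))).1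
  -- main claim
  have main : ∀ y, ‖y‖ ≤ 8 → g y ≤ v y := by
    obtain ⟨x0, hx0mem, hmax⟩ := (isCompact_closedBall (0 : EuclideanSpace ℝ (Fin (d+1))) 8).exists_isMaxOn
      ⟨0, by simp⟩ ((hgc.sub hv).continuousOn)
    have hx08 : ‖x0‖ ≤ 8 := by simpa using hx0mem
    have hmax' : ∀ y, ‖y‖ ≤ 8 → g y - v y ≤ g x0 - v x0 := fun y hy =>
      hmax (by simpa using hy)
    by_contra hcon
    push Not at hcon
    obtain ⟨y1, hy1, hy2⟩ := hcon
    set m := g x0 - v x0 with hm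
    have hmp : 0 < m := by linarith [hmax' y1 hy1]
    have hetapos : 0 < eta z x0 := by
      by_contra hn
      have e : eta z x0 = 0 := le_antisymm (not_lt.1 hn) (eta_nonneg _ _)
      have h1 := hv9 x0 hx08
      have h2 : 0 ≤ t * A * profW d s x0 := mul_nonneg (by positivity) (profW_nonneg _)
      have h3 : g x0 = -(t*A) * profW d s x0 - t := by simp only [hg, e]; ring
      linarith
    have hx0n : 0 < x0 (Fin.last d) := by
      by_contra hn
      have e := profW_zero (s := s) hs0 (not_lt.1 hn)
      have e2 := hv0 x0 (not_lt.1 hn)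
      have h3 : g x0 = t * eta z x0 - t := by simp only [hg, e]; ring
      have h4 : t * eta z x0 ≤ t * 1 := by gcongr; exact eta_le_one _ _
      linarith
    have hx03 : ‖x0‖ < 3 := by
      have := eta_near hetapos
      linarith [norm_sub_norm_le x0 z]
    have := hT v g x0 (t * C0) m t C (t*A + 2*t) hv hgc hsup hx0n hx03 ?_ ?_ (by rw [hm]; ring) ?_ ?_ ht0 ?_ ?_
    · have hFc : Continuous (fun z => v z - g z + m) := by fun_prop
      have h2 := intD_lower hFc (t*A + m) ?_
      · have h3 := mul_le_mul_of_nonneg_left h2 hc1.le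
        have h4 : 0 < c1 * V * m := by positivity
        have h5 : c1 * (V * (t * A + m)) = t * (c1 * V * A) + c1 * V * m := by ring
        rw [h5, hAe] at h3
        linarith
      · intro y hy
        have hn := mem_D hy
        have e : eta z y = 0 := eta_far (by linarith [norm_sub_norm_le y z])
        have h1 := hv9 y (by linarith)
        have h2 : t * A * 1 ≤ t * A * profW d s y := by gcongr; exact profW_D hs0 hy
        simp only [hg, e]
        linarith
    · exact ((contDiffAt_const.mul (profW_contDiffAt hx0n)).add (contDiffAt_const.mul (eta_contDiffAt hetapos))).sub contDiffAt_const
    · intro μ hμ hint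
      refine kerOp_lower hs0 hs1 hlam hμ hx0n hint (-(t*A)) t ht0 ?_
      intro y
      have h1 := mul_le_mul_of_nonneg_left (eta_second hs0 hs1 hetapos y) ht0
      simp only [hg]
      linarith
    · intro y hy
      linarith [hmax' y hy.le]
    · intro y hy
      have h1 : 0 ≤ t * A * profW d s y := mul_nonneg (by positivity) (profW_nonneg _)
      have h2 : t * eta z y ≤ t * 1 := by gcongr; exact eta_le_one _ _
      have h3 := (abs_le.1 (hgr (1 + ‖y‖) (by linarith) y (by linarith))).1
      have h4 : C * (1 + ‖y‖)^(3*s/2) ≤ t * ‖y‖^(3*s/2) := by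
        rw [ht, mul_assoc, ← Real.mul_rpow (by norm_num) (norm_nonneg _)]
        gcongr
        linarith
      simp only [hg]
      linarith
    · intro y
      exact hgr (1 + ‖y‖) (by linarith [norm_nonneg y]) y (by linarith)
    · intro y
      have h1 := profW_growth (d := d) hs0 y
      have h2 := one_le_grow (d := d) hs0 y
      rw [abs_of_nonneg (profW_nonneg _)] at h1
      have h3 := profW_nonneg (d := d) (s := s) y
      have h4 : t * A * profW d s y ≤ t * A * (1 * (1 + ‖y‖)^(3*s/2)) := by gcongr
      have h5 : t * 1 ≤ t * (1 + ‖y‖)^(3*s/2) := by gcongr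
      have h6 : t * eta z y ≤ t * 1 := by gcongr; exact eta_le_one _ _
      have h7 : 0 ≤ t * eta z y := mul_nonneg ht0 (eta_nonneg _ _)
      have h8 : 0 ≤ t * A * profW d s y := by positivity
      simp only [hg]
      rw [abs_le]
      constructor <;> linarith
  have h1 := main x (by linarith)
  have h2 : 1 - (x (Fin.last d))^2/4 ≤ eta z x := by
    rw [← hxz]; exact le_max_right _ _
  have hxle : x (Fin.last d) ≤ 1 := ((le_abs_self _).trans (coord_le_norm x _)).trans hx1.le
  have h3 : (x (Fin.last d))^2 ≤ profW d s x := by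
    unfold profW
    rw [max_eq_left hxn.le, ← Real.rpow_natCast]
    apply Real.rpow_le_rpow_of_exponent_ge hxn hxle
    push_cast; linarith
  have h4 := mul_le_mul_of_nonneg_left h2 ht0
  have h5 := mul_le_mul_of_nonneg_left h3 ht0
  have h6 : 0 ≤ t * profW d s x := mul_nonneg ht0 (profW_nonneg _)
  have h7 : (A + 1) * 9 ^ (3 * s / 2) * C * profW d s x = t * A * profW d s x + t * profW d s x := by
    rw [ht]; ring
  have h8 : 0 ≤ t * (x (Fin.last d))^2 := by positivity
  rw [h7]
  simp only [hg] at h1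
  linarith

lemma harn (d : ℕ) {s lam Lam : ℝ} (hs0 : 0 < s) (hs1 : s < 1) (hlam : 0 < lam) (hlL : lam ≤ Lam) :
    ∃ c1 C2 C0 : ℝ, 0 < c1 ∧ 0 ≤ C2 ∧ 0 ≤ C0 ∧ ∀ (v : EuclideanSpace ℝ (Fin (d+1)) → ℝ) (t σ Cv : ℝ),
      Continuous v → SupSol d s lam Lam v → 0 ≤ t → 0 ≤ σ → (∀ z, ‖z‖ < 8 → 0 ≤ v z) →
      (∀ z, 8 ≤ ‖z‖ → -(σ * ‖z‖^(3*s/2)) ≤ v z) → (∀ z, |v z| ≤ Cv * (1 + ‖z‖)^(3*s/2)) →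
      t * C0 + C2 * σ < c1 * ∫ z in ball (cD d) 1, v z →
      ∀ x, ‖x‖ < 1 → 3/4 * t * profW d s x ≤ v x := by
  obtain ⟨c1, C2, hc1, hC2, hT⟩ := touch d hs0 hs1 hlam hlL
  have hC0 : 0 ≤ constC d s Lam := constC_nonneg hs1 (by linarith)
  refine ⟨c1, C2, 4 * constC d s Lam, hc1, hC2, by positivity, ?_⟩
  intro v t σ Cv hv hsup ht0 hσ h8 htail hCv hbig x hx1
  set g : EuclideanSpace ℝ (Fin (d+1)) → ℝ := fun y => t * (profW d s y * eta 0 y) with hg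
  have hgc : Continuous g := by
    have := profW_continuous (d := d) hs0
    have := eta_continuous (0 : EuclideanSpace ℝ (Fin (d+1)))
    fun_prop
  have hgfar : ∀ y, 2 ≤ ‖y‖ → g y = 0 := by
    intro y hy
    have : eta 0 y = 0 := eta_far (by simpa using hy)
    simp [hg, this]
  have main : ∀ y, ‖y‖ ≤ 2 → g y ≤ v y := by
    obtain ⟨x0, hx0mem, hmax⟩ := (isCompact_closedBall (0 : EuclideanSpace ℝ (Fin (d+1))) 2).exists_isMaxOn
      ⟨0, by simp⟩ ((hgc.sub hv).continuousOn)
    have hx08 : ‖x0‖ ≤ 2 := by simpa using hx0mem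
    have hmax' : ∀ y, ‖y‖ ≤ 2 → g y - v y ≤ g x0 - v x0 := fun y hy =>
      hmax (by simpa using hy)
    by_contra hcon
    push Not at hcon
    obtain ⟨y1, hy1, hy2⟩ := hcon
    set m := g x0 - v x0 with hm
    have hmp : 0 < m := by linarith [hmax' y1 hy1]
    have hv0 := h8 x0 (by linarith)
    have hetapos : 0 < eta 0 x0 := by
      by_contra hn
      have e : eta 0 x0 = 0 := le_antisymm (not_lt.1 hn) (eta_nonneg _ _)
      have h3 : g x0 = 0 := by simp [hg, e]
      linarith
    have hx0n : 0 < x0 (Fin.last d) := by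
      by_contra hn
      have e := profW_zero (s := s) hs0 (not_lt.1 hn)
      have h3 : g x0 = 0 := by simp [hg, e]
      linarith
    have hx03 : ‖x0‖ < 3 := by linarith
    have := hT v g x0 (t * (4 * constC d s Lam)) m σ Cv t hv hgc hsup hx0n hx03 ?_ ?_ (by rw [hm]; ring) ?_ ?_ hσ hCv ?_
    · have hFc : Continuous (fun z => v z - g z + m) := by fun_prop
      have h2 : ∫ z in ball (cD d) 1, v z ≤ ∫ z in ball (cD d) 1, (v z - g z + m) := by
        refine setIntegral_mono_on (intD hv) (intD hFc) measurableSet_ball ?_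
        intro y hy
        rw [hgfar y (by linarith [(mem_D hy).1])]
        linarith
      have h3 := mul_le_mul_of_nonneg_left h2 hc1.le
      linarith
    · exact contDiffAt_const.mul ((profW_contDiffAt hx0n).mul (eta_contDiffAt hetapos))
    · intro μ hμ hint
      have := kerOp_lower hs0 hs1 hlam hμ hx0n hint (t * eta 0 x0) (4*t) (by positivity) ?_
      · linarith
      intro y
      have h1 := mul_le_mul_of_nonneg_left (weta_second hs0 hs1 hetapos hx03 y) ht0
      simp only [hg]
      linarith
    · intro y hy
      rcases le_total ‖y‖ 2 with h | h
      · linarith [hmax' y h]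
      · rw [hgfar y h]; linarith [h8 y hy]
    · intro y hy
      rw [hgfar y (by linarith)]; linarith [htail y hy]
    · intro y
      have h1 := profW_growth (d := d) hs0 y
      rw [abs_of_nonneg (profW_nonneg _)] at h1
      have h3 := profW_nonneg (d := d) (s := s) y
      have h4 := eta_nonneg 0 y
      have h5 := eta_le_one 0 y
      simp only [hg]
      rw [abs_of_nonneg (by positivity)]
      have h6 : profW d s y * eta 0 y ≤ profW d s y * 1 := by gcongr
      have : profW d s y * eta 0 y ≤ (1 + ‖y‖)^(3*s/2) := by linarith
      gcongr
  refine le_trans ?_ (main x (by linarith))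
  have h2 : 3/4 ≤ eta 0 x := by
    refine le_trans ?_ (le_max_right _ _)
    rw [sub_zero]
    nlinarith [norm_nonneg x]
  have h3 := mul_le_mul_of_nonneg_left h2 (mul_nonneg ht0 (profW_nonneg (d := d) (s := s) x))
  simp only [hg]
  linarith


lemma bern {X p γ : ℝ} (hX : 1 ≤ X) (hp : 0 < p) (hγ : 0 ≤ γ) (hγp : γ ≤ p) : X^γ ≤ 1 + γ/p * X^p := by
  have h0 : 0 ≤ X := by linarith
  have h1 : 0 ≤ X^p := by positivity
  have h := rpow_one_add_le_one_add_mul_self (s := X^p - 1) (by linarith) (p := γ/p) (by positivity)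
    ((div_le_one hp).2 hγp)
  rw [add_sub_cancel, ← Real.rpow_mul h0, mul_div_cancel₀ _ hp.ne'] at h
  have : 0 ≤ γ/p := by positivity
  linarith

lemma improve (d : ℕ) {s lam Lam : ℝ} (hs0 : 0 < s) (hs1 : s < 1) (hlam : 0 < lam) (hlL : lam ≤ Lam) :
    ∃ γ θ : ℝ, 0 < γ ∧ γ ≤ s/2 ∧ 0 < θ ∧ θ < 1 ∧ ∀ (u : EuclideanSpace ℝ (Fin (d+1)) → ℝ) (Cu : ℝ), Continuous u →
      SupSol d s lam Lam u → SupSol d s lam Lam (fun x => - u x) →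
      (∀ x, x (Fin.last d) ≤ 0 → u x = 0) →
      (∀ z, |u z| ≤ Cu * (1 + ‖z‖)^(3*s/2)) →
      (∀ R : ℝ, 1 ≤ R → ∃ m : ℝ, ∀ x, ‖x‖ < R → m * profW d s x ≤ u x ∧ u x ≤ (m + R^γ) * profW d s x) →
      ∃ m : ℝ, ∀ x, ‖x‖ < 1 → m * profW d s x ≤ u x ∧ u x ≤ (m + (1-θ)) * profW d s x := by
  obtain ⟨c1, C2, C0, hc1, hC2, hC0, hH⟩ := harn d hs0 hs1 hlam hlL
  set V := (volume : Measure (EuclideanSpace ℝ (Fin (d+1)))).real (ball (cD d) 1) with hV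
  have hVp : 0 < V := volD_pos d
  set K := c1 * V / 4 with hK
  have hKp : 0 < K := by positivity
  obtain ⟨t, ht0, ht1, htC⟩ : ∃ t : ℝ, 0 < t ∧ t ≤ 1 ∧ t * C0 ≤ K/4 := by
    refine ⟨min 1 (K/(4*(C0+1))), by positivity, min_le_left _ _, ?_⟩
    have h1 : min 1 (K/(4*(C0+1))) * C0 ≤ (K/(4*(C0+1))) * (C0+1) := by
      gcongr
      · exact min_le_right _ _
      · linarith
    have h2 : (K/(4*(C0+1))) * (C0+1) = K/4 := by field_simp
    linarith
  obtain ⟨γ, hγ0, hγs, hγt, hγC⟩ : ∃ γ : ℝ, 0 < γ ∧ γ ≤ s/2 ∧ γ ≤ t/28 ∧ C2 * (4*γ/s) ≤ K/4 := by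
    refine ⟨min (min (s/2) (t/28)) (s*K/(16*(C2+1))), by positivity,
      (min_le_left _ _).trans (min_le_left _ _), (min_le_left _ _).trans (min_le_right _ _), ?_⟩
    have h1 : C2 * (4 * (min (min (s/2) (t/28)) (s*K/(16*(C2+1))))/s) ≤ (C2+1) * (4 * (s*K/(16*(C2+1)))/s) := by
      gcongr
      · linarith
      · exact min_le_right _ _
    have h2 : (C2+1) * (4 * (s*K/(16*(C2+1)))/s) = K/4 := by field_simp; norm_num
    linarith
  obtain ⟨θ, hθ0, hθ2, hθt, hθC⟩ : ∃ θ : ℝ, 0 < θ ∧ θ ≤ 1/2 ∧ θ ≤ t/2 ∧ C2 * θ ≤ K/4 := by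
    refine ⟨min (min (1/2) (t/2)) (K/(4*(C2+1))), by positivity,
      (min_le_left _ _).trans (min_le_left _ _), (min_le_left _ _).trans (min_le_right _ _), ?_⟩
    have h1 : C2 * (min (min (1/2) (t/2)) (K/(4*(C2+1)))) ≤ (C2+1) * (K/(4*(C2+1))) := by
      gcongr
      · linarith
      · exact min_le_right _ _
    have h2 : (C2+1) * (K/(4*(C2+1))) = K/4 := by field_simp
    linarith
  refine ⟨γ, θ, hγ0, hγs, hθ0, by linarith, ?_⟩
  intro u Cu hu hsu hsnu hu0 hCu hR
  -- bounds of the quotient on the ball of radius 8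
  set S : Set ℝ := {q | ∃ x : EuclideanSpace ℝ (Fin (d+1)), ‖x‖ < 8 ∧ 0 < x (Fin.last d) ∧ q = u x / profW d s x} with hS
  have hSne : S.Nonempty := by
    refine ⟨_, cD d, ?_, ?_, rfl⟩
    · rw [cD_norm]; norm_num
    · simp [cD]
  have hSb : ∀ R : ℝ, 8 ≤ R → ∀ m : ℝ, (∀ x, ‖x‖ < R → m * profW d s x ≤ u x ∧ u x ≤ (m + R^γ) * profW d s x) →
      ∀ q ∈ S, m ≤ q ∧ q ≤ m + R^γ := by
    rintro R hR8 m hm q ⟨x, hx8, hxn, rfl⟩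
    have hp := profW_pos (s := s) hxn
    have := hm x (by linarith)
    exact ⟨(le_div_iff₀ hp).2 this.1, (div_le_iff₀ hp).2 this.2⟩
  obtain ⟨m0, hm0⟩ := hR 8 (by norm_num)
  have hS0 := hSb 8 le_rfl m0 hm0
  have hbb : BddBelow S := ⟨m0, fun q hq => (hS0 q hq).1⟩
  have hba : BddAbove S := ⟨m0 + 8^γ, fun q hq => (hS0 q hq).2⟩
  set m8 := sInf S with hm8
  set M8 := sSup S with hM8
  have hmM : ∀ x, ‖x‖ < 8 → m8 * profW d s x ≤ u x ∧ u x ≤ M8 * profW d s x := by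
    intro x hx
    rcases le_or_gt (x (Fin.last d)) 0 with hxn | hxn
    · rw [hu0 x hxn, profW_zero hs0 hxn]; simp
    · have hp := profW_pos (s := s) hxn
      have hq : u x / profW d s x ∈ S := ⟨x, hx, hxn, rfl⟩
      exact ⟨(le_div_iff₀ hp).1 (csInf_le hbb hq), (div_le_iff₀ hp).1 (le_csSup hba hq)⟩
  have hosc : M8 - m8 ≤ 8^γ := by
    have h1 : m0 ≤ m8 := le_csInf hSne fun q hq => (hS0 q hq).1
    have h2 : M8 ≤ m0 + 8^γ := csSup_le hSne fun q hq => (hS0 q hq).2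
    linarith
  have h8γ : (8:ℝ)^γ ≤ 1 + t/4 := by
    have := rpow_one_add_le_one_add_mul_self (s := (7:ℝ)) (by norm_num) (p := γ) hγ0.le (by linarith)
    norm_num at this
    linarith
  rcases le_or_gt (M8 - m8) (1 - θ) with hsm | hbig
  · refine ⟨m8, fun x hx => ⟨(hmM x (by linarith)).1, (hmM x (by linarith)).2.trans ?_⟩⟩
    have := profW_nonneg (d := d) (s := s) x
    gcongr
    linarith
  set σ := 4*γ/s + θ with hσ
  have hσ0 : 0 ≤ σ := by positivity
  -- tail bounds
  have htail : ∀ z, 8 ≤ ‖z‖ → -(σ * ‖z‖^(3*s/2)) ≤ u z - m8 * profW d s z ∧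
      -(σ * ‖z‖^(3*s/2)) ≤ M8 * profW d s z - u z := by
    intro z hz
    obtain ⟨m, hm⟩ := hR (2*‖z‖) (by linarith)
    have hSR := hSb (2*‖z‖) (by linarith) m hm
    have h1 : m ≤ m8 := le_csInf hSne fun q hq => (hSR q hq).1
    have h2 : M8 ≤ m + (2*‖z‖)^γ := csSup_le hSne fun q hq => (hSR q hq).2
    have hzz := hm z (by linarith)
    have hw0 := profW_nonneg (d := d) (s := s) z
    have hw1 := profW_le (d := d) hs0 z
    have hb := bern (X := 2*‖z‖) (p := s/2) (by linarith) (by positivity) hγ0.le hγs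
    have h2s : (2*‖z‖)^(s/2) ≤ 2 * ‖z‖^(s/2) := by
      rw [Real.mul_rpow (by norm_num) (norm_nonneg _)]
      gcongr
      calc (2:ℝ)^(s/2) ≤ 2^(1:ℝ) := Real.rpow_le_rpow_of_exponent_le (by norm_num) (by linarith)
        _ = 2 := Real.rpow_one _
    have hone : 1 ≤ ‖z‖^(s/2) := Real.one_le_rpow (by linarith) (by positivity)
    have hcoef : (2*‖z‖)^γ - 1 + θ ≤ σ * ‖z‖^(s/2) := by
      have e1 : γ/(s/2) * (2*‖z‖)^(s/2) ≤ γ/(s/2) * (2 * ‖z‖^(s/2)) := by gcongr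
      have e2 : γ/(s/2) * (2 * ‖z‖^(s/2)) = 4*γ/s * ‖z‖^(s/2) := by field_simp; norm_num
      have e3 : θ * 1 ≤ θ * ‖z‖^(s/2) := by gcongr
      rw [hσ, add_mul]
      linarith
    have hfin : ((2*‖z‖)^γ - 1 + θ) * profW d s z ≤ σ * ‖z‖^(3*s/2) := by
      have e : ‖z‖^(3*s/2) = ‖z‖^(s/2) * ‖z‖^s := by
        rw [← Real.rpow_add (by linarith)]; congr 1; ring
      rw [e, ← mul_assoc]
      gcongr
    constructor
    · have : (m8 - m) * profW d s z ≤ ((2*‖z‖)^γ - 1 + θ) * profW d s z := by gcongr; linarith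
      linarith [hzz.1]
    · have : (m + (2*‖z‖)^γ - M8) * profW d s z ≤ ((2*‖z‖)^γ - 1 + θ) * profW d s z := by gcongr; linarith
      linarith [hzz.2]
  have hwc := profW_continuous (d := d) hs0
  have hc1' : Continuous (fun x => u x + (-m8) * profW d s x) := by fun_prop
  have hc2' : Continuous (fun x => -u x + M8 * profW d s x) := by fun_prop
  have hgr : ∀ a b : ℝ, |a| ≤ 1 → ∀ z, |a * u z + b * profW d s z| ≤ (Cu + |b|) * (1 + ‖z‖)^(3*s/2) := by
    intro a b ha z
    have h1 := hCu z
    have h2 := profW_growth (d := d) hs0 z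
    calc _ ≤ |a| * |u z| + |b| * |profW d s z| := by rw [← abs_mul, ← abs_mul]; exact abs_add_le _ _
      _ ≤ 1 * |u z| + |b| * (1 * (1 + ‖z‖)^(3*s/2)) := by gcongr
      _ ≤ _ := by linarith
  have hsum : V * (1 - θ) ≤ (∫ z in ball (cD d) 1, (u z + (-m8) * profW d s z)) +
      ∫ z in ball (cD d) 1, (-u z + M8 * profW d s z) := by
    rw [← integral_add (intD hc1') (intD hc2')]
    apply intD_lower (hc1'.add hc2')
    intro z hz
    have := profW_D hs0 hz
    change 1 - θ ≤ (u z + -m8 * profW d s z) + (-u z + M8 * profW d s z)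
    nlinarith
  have hKey : t * C0 + C2 * σ < K := by
    rw [hσ, mul_add]; linarith
  have hor : V/4 ≤ (∫ z in ball (cD d) 1, (u z + (-m8) * profW d s z)) ∨
      V/4 ≤ ∫ z in ball (cD d) 1, (-u z + M8 * profW d s z) := by
    by_contra hcon
    push Not at hcon
    nlinarith
  rcases hor with hv | hv
  · have := hH _ t σ (Cu + |(-m8)|) hc1' (hsu.add_profW hs0 hs1 hlam (-m8)) ht0.le hσ0
      (fun z hz => by linarith [(hmM z hz).1]) (fun z hz => by linarith [(htail z hz).1])
      (fun z => by simpa using hgr 1 (-m8) (by simp) z) (by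
        have := mul_le_mul_of_nonneg_left hv hc1.le
        linarith)
    refine ⟨m8 + 3/4*t, fun x hx => ⟨by linarith [this x hx], ?_⟩⟩
    refine (hmM x (by linarith)).2.trans ?_
    have := profW_nonneg (d := d) (s := s) x
    gcongr
    linarith
  · have := hH _ t σ (Cu + |M8|) hc2' (hsnu.add_profW hs0 hs1 hlam M8) ht0.le hσ0
      (fun z hz => by linarith [(hmM z hz).2]) (fun z hz => by linarith [(htail z hz).2])
      (fun z => by simpa using hgr (-1) M8 (by simp) z) (by
        have := mul_le_mul_of_nonneg_left hv hc1.le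
        linarith)
    refine ⟨m8, fun x hx => ⟨(hmM x (by linarith)).1, ?_⟩⟩
    have h1 := this x hx
    have h2 : (M8 - 3/4*t) * profW d s x ≤ (m8 + (1-θ)) * profW d s x := by
      have := profW_nonneg (d := d) (s := s) x
      gcongr
      linarith
    linarith

lemma profW_smul {d : ℕ} {s R : ℝ} (hR : 0 < R) (x : EuclideanSpace ℝ (Fin (d+1))) :
    profW d s (R • x) = R^s * profW d s x := by
  unfold profW
  rw [← Real.mul_rpow hR.le (le_max_right _ _), mul_max_of_nonneg _ _ hR.le]
  simp


theorem stmt14 (d : ℕ) (s lam Lam : ℝ) (hs0 : 0 < s) (hs1 : s < 1)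
    (hlam : 0 < lam) (hlL : lam ≤ Lam) :
    ∃ abar : ℝ, 0 < abar ∧
      ∀ u : EuclideanSpace ℝ (Fin (d + 1)) → ℝ, Continuous u →
        ViscSub (d + 1) s lam Lam u
            {x : EuclideanSpace ℝ (Fin (d + 1)) | 0 < x (Fin.last d)} →
        ViscSuper (d + 1) s lam Lam u
            {x : EuclideanSpace ℝ (Fin (d + 1)) | 0 < x (Fin.last d)} →
        (∀ x : EuclideanSpace ℝ (Fin (d + 1)), x (Fin.last d) < 0 → u x = 0) →
        ∀ β C : ℝ, β < s + abar →
          (∀ R : ℝ, 1 ≤ R → ∀ x : EuclideanSpace ℝ (Fin (d + 1)),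
            ‖x‖ < R → |u x| ≤ C * R ^ β) →
          ∃ K : ℝ, ∀ x : EuclideanSpace ℝ (Fin (d + 1)),
            u x = K * (max (x (Fin.last d)) 0) ^ s := by
  obtain ⟨γ, θ, hγ0, hγs, hθ0, hθ1, himp⟩ := improve d hs0 hs1 hlam hlL
  obtain ⟨A', hA'0, hlow⟩ := lower_b d hs0 hs1 hlam hlL
  refine ⟨γ, hγ0, ?_⟩
  intro u hu hsub hsuper hneg β C hβ hgrow
  have hsu : SupSol d s lam Lam u := SupSol.of_viscSuper hlL hsuper
  have hsnu : SupSol d s lam Lam (fun x => - u x) := SupSol.of_viscSub hlL hsub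
  -- u vanishes on the closed lower half-space
  have hu0 : ∀ x : EuclideanSpace ℝ (Fin (d + 1)), x (Fin.last d) ≤ 0 → u x = 0 := by
    intro x hx
    set e : EuclideanSpace ℝ (Fin (d + 1)) := EuclideanSpace.single (Fin.last d) (1:ℝ) with he
    have hlim : Filter.Tendsto (fun δ : ℝ => u (x - δ • e)) (nhdsWithin 0 (Ioi 0)) (nhds (u x)) := by
      have h1 : Continuous (fun δ : ℝ => u (x - δ • e)) := by fun_prop
      have := h1.tendsto 0
      simp only [zero_smul, sub_zero] at this
      exact this.mono_left nhdsWithin_le_nhds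
    have hz : Filter.Tendsto (fun δ : ℝ => u (x - δ • e)) (nhdsWithin 0 (Ioi 0)) (nhds 0) := by
      apply tendsto_const_nhds.congr'
      filter_upwards [self_mem_nhdsWithin] with δ hδ
      have hδ : 0 < δ := hδ
      refine (hneg _ ?_).symm
      have : (x - δ • e) (Fin.last d) = x (Fin.last d) - δ := by simp [he]
      rw [this]; linarith
    exact tendsto_nhds_unique hlim hz
  have hC : 0 ≤ C := by
    have := (abs_nonneg _).trans (hgrow 1 le_rfl 0 (by simp))
    simpa using this
  have hgrow' : ∀ R : ℝ, 1 ≤ R → ∀ x : EuclideanSpace ℝ (Fin (d + 1)), ‖x‖ < R → |u x| ≤ C * R ^ (s+γ) := by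
    intro R hR x hx
    refine (hgrow R hR x hx).trans ?_
    gcongr
  -- scaled growth
  have hscale : ∀ R : ℝ, 1 ≤ R → ∀ S : ℝ, 1 ≤ S → ∀ x : EuclideanSpace ℝ (Fin (d + 1)), ‖x‖ < S →
      |(R^(s+γ))⁻¹ * u (R • x)| ≤ C * S^(3*s/2) := by
    intro R hR S hS x hx
    have hR0 : 0 < R := by linarith
    have h1 := hgrow' (R*S) (by nlinarith) (R • x) (by
      rw [norm_smul, Real.norm_of_nonneg hR0.le]; gcongr)
    have hRp : 0 < R^(s+γ) := Real.rpow_pos_of_pos hR0 _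
    rw [abs_mul, abs_of_pos (inv_pos.2 hRp), inv_mul_le_iff₀ hRp]
    rw [Real.mul_rpow hR0.le (by linarith)] at h1
    have h2 : S^(s+γ) ≤ S^(3*s/2) := Real.rpow_le_rpow_of_exponent_le hS (by linarith)
    calc _ ≤ C * (R^(s+γ) * S^(s+γ)) := h1
      _ ≤ C * (R^(s+γ) * S^(3*s/2)) := by gcongr
      _ = _ := by ring
  have hball : ∀ R : ℝ, 1 ≤ R → ∀ y : EuclideanSpace ℝ (Fin (d + 1)), ‖y‖ < R →
      ∃ x : EuclideanSpace ℝ (Fin (d + 1)), ‖x‖ < 1 ∧ R • x = y := by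
    intro R hR y hy
    have hR0 : 0 < R := by linarith
    refine ⟨R⁻¹ • y, ?_, ?_⟩
    · rw [norm_smul, norm_inv, Real.norm_of_nonneg hR0.le, inv_mul_lt_iff₀ hR0]; linarith
    · rw [smul_smul, mul_inv_cancel₀ hR0.ne', one_smul]
  have hneg0 : ∀ (c R : ℝ), 0 < R → ∀ x : EuclideanSpace ℝ (Fin (d + 1)), x (Fin.last d) ≤ 0 → c * u (R • x) = 0 := by
    intro c R hR x hx
    rw [hu0, mul_zero]
    have : (R • x) (Fin.last d) = R * x (Fin.last d) := by simp
    rw [this]; exact mul_nonpos_of_nonneg_of_nonpos hR.le hx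
  -- the statement to be iterated
  set P : ℝ → Prop := fun A => ∀ R : ℝ, 1 ≤ R → ∃ m : ℝ, ∀ x : EuclideanSpace ℝ (Fin (d + 1)), ‖x‖ < R →
    m * profW d s x ≤ u x ∧ u x ≤ (m + A * R^γ) * profW d s x with hP
  have hP0 : P (2 * (A' * C) + 1) := by
    intro R hR
    have hR0 : 0 < R := by linarith
    have hRp : 0 < R^(s+γ) := Real.rpow_pos_of_pos hR0 _
    have h1 := hlow (fun x => (R^(s+γ))⁻¹ * u (R • x)) C (by fun_prop)
      (hsu.scale _ _ (inv_pos.2 hRp) hR0) (hneg0 _ R hR0) (hscale R hR)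
    have h2 := hlow (fun x => (R^(s+γ))⁻¹ * (- u (R • x))) C (by fun_prop)
      (hsnu.scale _ _ (inv_pos.2 hRp) hR0) (fun x hx => by
        have := hneg0 ((R^(s+γ))⁻¹) R hR0 x hx
        linarith) (fun S hS x hx => by
        rw [mul_neg, abs_neg]; exact hscale R hR S hS x hx)
    refine ⟨-(A' * C) * R^γ, ?_⟩
    intro y hy
    obtain ⟨x, hx, rfl⟩ := hball R hR y hy
    have k1 := h1 x hx
    have k2 := h2 x hx
    rw [le_inv_mul_iff₀ hRp] at k1 k2
    have hw := profW_nonneg (d := d) (s := s) x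
    rw [profW_smul hR0]
    rw [Real.rpow_add hR0] at k1 k2
    have hRs : 0 < R^s := Real.rpow_pos_of_pos hR0 _
    have hRg : 0 < R^γ := Real.rpow_pos_of_pos hR0 _
    have hpos : 0 ≤ R^γ * (R^s * profW d s x) := by positivity
    constructor <;> linarith
  have hstep : ∀ A : ℝ, 0 < A → P A → P ((1-θ) * A) := by
    intro A hA hPA R hR
    have hR0 : 0 < R := by linarith
    have hRs : 0 < R^s := Real.rpow_pos_of_pos hR0 _
    have hRg : 0 < R^γ := Real.rpow_pos_of_pos hR0 _
    have hRp : 0 < R^(s+γ) := Real.rpow_pos_of_pos hR0 _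
    have hRe : R^(s+γ) = R^s * R^γ := Real.rpow_add hR0 _ _
    set c := A⁻¹ * (R^(s+γ))⁻¹ with hc
    have hcp : 0 < c := by positivity
    have hceq : c * (R^s * (A * R^γ)) = 1 := by rw [hc, hRe]; field_simp
    obtain ⟨m, hm⟩ := himp (fun x => c * u (R • x)) (A⁻¹ * C) (by fun_prop) (hsu.scale c R hcp hR0)
      (by
        have := hsnu.scale c R hcp hR0
        simpa only [mul_neg] using this)
      (hneg0 c R hR0)
      (fun z => by
        have := hscale R hR (1 + ‖z‖) (by linarith [norm_nonneg z]) z (by linarith)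
        rw [hc, mul_assoc, abs_mul, abs_of_pos (inv_pos.2 hA), mul_assoc]
        gcongr)
      (by
        intro ρ hρ
        have hρ0 : 0 < ρ := by linarith
        obtain ⟨m, hm⟩ := hPA (R*ρ) (by nlinarith)
        refine ⟨m * (c * R^s), fun x hx => ?_⟩
        have h := hm (R • x) (by rw [norm_smul, Real.norm_of_nonneg hR0.le]; gcongr)
        rw [profW_smul hR0, Real.mul_rpow hR0.le hρ0.le] at h
        have k1 := mul_le_mul_of_nonneg_left h.1 hcp.le
        have k2 := mul_le_mul_of_nonneg_left h.2 hcp.le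
        refine ⟨by linarith, k2.trans (le_of_eq ?_)⟩
        linear_combination (ρ^γ * profW d s x) * hceq)
    refine ⟨m * (A * R^γ), ?_⟩
    intro y hy
    obtain ⟨x, hx, rfl⟩ := hball R hR y hy
    have h := hm x hx
    rw [profW_smul hR0]
    have hq : 0 ≤ R^s * (A * R^γ) := by positivity
    have k1 := mul_le_mul_of_nonneg_left h.1 hq
    have k2 := mul_le_mul_of_nonneg_left h.2 hq
    have e : R^s * (A * R^γ) * (c * u (R • x)) = u (R • x) := by linear_combination (u (R • x)) * hceq
    rw [e] at k1 k2
    constructor <;> linarith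
  set A0 := 2 * (A' * C) + 1 with hA0
  have hA0p : 0 < A0 := by positivity
  have h1θ : 0 < 1 - θ := by linarith
  have hiter : ∀ k : ℕ, P ((1-θ)^k * A0) := by
    intro k
    induction k with
    | zero => simpa using hP0
    | succ k ih =>
      have := hstep _ (by positivity) ih
      have e : (1-θ)^(k+1) * A0 = (1-θ) * ((1-θ)^k * A0) := by ring
      rw [e]; exact this
  set e : EuclideanSpace ℝ (Fin (d + 1)) := EuclideanSpace.single (Fin.last d) (1:ℝ) with he
  have hwe : profW d s e = 1 := by simp [profW, he]
  have hen : ‖e‖ = 1 := by simp [he]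
  refine ⟨u e, fun x => ?_⟩
  change u x = u e * profW d s x
  set R := ‖x‖ + 2 with hR
  have hkey : ∀ k : ℕ, |u x - u e * profW d s x| ≤ (1-θ)^k * (A0 * R^γ * profW d s x) := by
    intro k
    obtain ⟨m, hm⟩ := hiter k R (by linarith [norm_nonneg x])
    have h1 := hm x (by linarith)
    have h2 := hm e (by rw [hen]; linarith [norm_nonneg x])
    rw [hwe] at h2
    have hw := profW_nonneg (d := d) (s := s) x
    have h3 := mul_le_mul_of_nonneg_right h2.1 hw
    have h4 := mul_le_mul_of_nonneg_right h2.2 hw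
    rw [abs_le]
    constructor <;> linarith
  have hlim : Filter.Tendsto (fun k : ℕ => (1-θ)^k * (A0 * R^γ * profW d s x)) Filter.atTop (nhds 0) := by
    have := (tendsto_pow_atTop_nhds_zero_of_lt_one h1θ.le (by linarith : 1 - θ < 1)).mul_const (A0 * R^γ * profW d s x)
    simpa using this
  have h0 := ge_of_tendsto' hlim hkey
  have := abs_eq_zero.1 (le_antisymm h0 (abs_nonneg _))
  linarith
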